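/- arXiv:1905.10879 — 7 statements merged into one kernel-verified Lean document; each statement's English description precedes it below -/
import Mathlib

section
/- Let N ≥ 4 be an integer and let Θ : ℝ^{N-3} → ℂ be a smooth function with compact support. Then the integral Z_Θ^(N)(s) = ∫_{ℝ^{N-3}} Θ(x) ∏_{j=2}^{N-2} |x_j|^{s_{1j}} |1−x_j|^{s_{(N-1)j}} ∏_{2≤i<j≤N-2} |x_i−x_j|^{s_{ij}} ∏ dx_i converges absolutely and defines a holomorphic function of s = (s_{ij}) ∈ ℂ^{N(N-3)/2} on the open set where Re(s_{ij}) > −2/(N−2) for every index pair ij. -/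
open MeasureTheory Finset

/-- The integrand of the real Koba-Nielsen local zeta function `Z^(N)(s)`.
The variables `x 0, …, x (N-4)` represent `x_2, …, x_{N-2}`; `a j` is `s_{1,(j+2)}`,
`b j` is `s_{(N-1),(j+2)}`, and `c i j` (for `i < j`) is `s_{(i+2),(j+2)}`. -/
noncomputable def KNintegrand (N : ℕ) (a b : Fin (N - 3) → ℂ)
    (c : Fin (N - 3) → Fin (N - 3) → ℂ) (x : Fin (N - 3) → ℝ) : ℂ :=
  (∏ j, ((|x j| : ℝ) : ℂ) ^ a j) * (∏ j, ((|1 - x j| : ℝ) : ℂ) ^ b j) *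
    ∏ p ∈ Finset.univ.filter (fun p : Fin (N - 3) × Fin (N - 3) => p.1 < p.2),
      ((|x p.1 - x p.2| : ℝ) : ℂ) ^ c p.1 p.2

/-- The region `Re(s_{ij}) > lo` for all relevant index pairs `ij`. -/
def KNregionLower (N : ℕ) (lo : ℝ) :
    Set ((Fin (N - 3) → ℂ) × (Fin (N - 3) → ℂ) × (Fin (N - 3) → Fin (N - 3) → ℂ)) :=
  {s | (∀ j, lo < (s.1 j).re) ∧ (∀ j, lo < (s.2.1 j).re) ∧
       (∀ i j, i < j → lo < (s.2.2 i j).re)}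

/-- A product of integrable functions of the coordinates, precomposed with the shear that
subtracts the `i`-th coordinate from all the others, is integrable. -/
lemma integrable_prod_shear {ι : Type*} [Fintype ι] [DecidableEq ι] (i : ι) {f : ι → ℝ → ℝ}
    (hf : ∀ u, Integrable (f u)) :
    Integrable (fun x : ι → ℝ => ∏ u, f u (if u = i then x u else x u - x i)) := by
  let L : (ι → ℝ) ≃ₗ[ℝ] (ι → ℝ) :=
    { toFun := fun x u => if u = i then x u else x u - x i
      invFun := fun x u => if u = i then x u else x u + x i
      map_add' := fun x y => by
        ext u
        by_cases h : u = i
        · simp [h]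
        · simp only [h, if_false, Pi.add_apply]; ring
      map_smul' := fun c x => by
        ext u
        by_cases h : u = i
        · simp [h]
        · simp only [h, if_false, Pi.smul_apply, smul_eq_mul, RingHom.id_apply]; ring
      left_inv := fun x => by
        ext u
        by_cases h : u = i <;> simp [h]
      right_inv := fun x => by
        ext u
        by_cases h : u = i <;> simp [h] }
  have hmap := Real.map_linearMap_volume_pi_eq_smul_volume_pi L.isUnit_det'.ne_zero
  have hprod : Integrable (fun y : ι → ℝ => ∏ u, f u (y u)) := Integrable.fintype_prod hf
  have hint : Integrable (fun y : ι → ℝ => ∏ u, f u (y u))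
      (Measure.map (L : (ι → ℝ) →ₗ[ℝ] (ι → ℝ)) volume) := by
    rw [hmap]
    exact hprod.smul_measure ENNReal.ofReal_ne_top
  exact hint.comp_measurable
    (LinearMap.continuous_on_pi (L : (ι → ℝ) →ₗ[ℝ] (ι → ℝ))).measurable

lemma integrableOn_abs_rpow_neg {γ : ℝ} (hγ : γ < 1) (R : ℝ) :
    IntegrableOn (fun t : ℝ => |t| ^ (-γ)) (Set.Icc (-R) R) := by
  rcases lt_or_ge R 0 with hR | hR
  · rw [Set.Icc_eq_empty (by linarith)]
    exact integrableOn_empty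
  have h := (intervalIntegral.intervalIntegrable_rpow' (a := 0) (b := R) (r := -γ)
    (by linarith))
  have hpos : IntervalIntegrable (fun t : ℝ => |t| ^ (-γ)) volume 0 R := by
    refine h.congr fun t ht => ?_
    rw [Set.uIoc_of_le hR] at ht
    simp [abs_of_pos ht.1]
  have hneg : IntervalIntegrable (fun t : ℝ => |t| ^ (-γ)) volume (-R) 0 := by
    have := (IntervalIntegrable.iff_comp_neg (f := fun t : ℝ => |t| ^ (-γ))
      (a := 0) (b := R)).1 hpos
    simpa using this.symm
  exact (intervalIntegrable_iff_integrableOn_Icc_of_le (by linarith)).1 (hneg.trans hpos)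

lemma integrableOn_abs_rpow_neg_mul_abs_one_sub_rpow_neg {γ : ℝ} (h0 : 0 ≤ γ) (h1 : γ < 1)
    {R : ℝ} :
    IntegrableOn (fun t : ℝ => |t| ^ (-γ) * |1 - t| ^ (-γ)) (Set.Icc (-R) R) := by
  have hA := integrableOn_abs_rpow_neg h1 R
  have hB : IntegrableOn (fun t : ℝ => |1 - t| ^ (-γ)) (Set.Icc (-R) R) := by
    have hi := (integrable_indicator_iff measurableSet_Icc).2
      (integrableOn_abs_rpow_neg h1 (R + 1))
    have hc := (hi.comp_sub_left 1).integrableOn (s := Set.Icc (-R) R)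
    refine hc.congr_fun (fun t ht => ?_) measurableSet_Icc
    refine Set.indicator_of_mem (s := Set.Icc (-(R + 1)) (R + 1)) ?_ _
    constructor <;> linarith [ht.1, ht.2]
  refine Integrable.mono' ((hA.add hB).const_mul (2 ^ γ)) ?_ (ae_of_all _ fun t => ?_)
  · exact Measurable.aestronglyMeasurable (by fun_prop)
  have key : ∀ a b : ℝ, 1 / 2 ≤ |a| → |a| ^ (-γ) * |b| ^ (-γ) ≤ 2 ^ γ * |b| ^ (-γ) := by
    intro a b ha
    gcongr
    calc |a| ^ (-γ) ≤ (1 / 2 : ℝ) ^ (-γ) :=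
          Real.rpow_le_rpow_of_nonpos (by norm_num) ha (by linarith)
      _ = 2 ^ γ := by rw [one_div, Real.inv_rpow (by norm_num), Real.rpow_neg (by norm_num), inv_inv]
  have hp : ∀ a : ℝ, 0 ≤ 2 ^ γ * |a| ^ (-γ) := fun a => by positivity
  rw [Real.norm_of_nonneg (by positivity), Pi.add_apply, mul_add]
  rcases le_total (1 / 2) |t| with h | h
  · linarith [key t (1 - t) h, hp t]
  · have h' : 1 / 2 ≤ |1 - t| := by
      linarith [abs_sub_abs_le_abs_sub 1 t, abs_one (α := ℝ)]
    linarith [key (1 - t) t h', hp (1 - t), mul_comm (|t| ^ (-γ)) (|1 - t| ^ (-γ))]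

/-- Every pair is counted twice when the products over the stars of a complete graph are
multiplied together. -/
lemma prod_prod_erase_eq_sq {ι : Type*} [Fintype ι] [LinearOrder ι] (K : ι → ι → ℝ)
    (hK : ∀ i j, K i j = K j i) :
    ∏ i, ∏ u ∈ univ.erase i, K u i = (∏ p : ι × ι with p.1 < p.2, K p.1 p.2) ^ 2 := by
  have h1 : ∏ i, ∏ u ∈ univ.erase i, K u i = ∏ p : ι × ι with p.1 ≠ p.2, K p.1 p.2 := by
    rw [prod_filter, Fintype.prod_prod_type_right]
    refine prod_congr rfl fun i _ => ?_
    rw [← prod_filter]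
    refine prod_congr ?_ fun _ _ => rfl
    ext; simp
  have h2 : ∏ p : ι × ι with p.2 < p.1, K p.1 p.2 = ∏ p : ι × ι with p.1 < p.2, K p.1 p.2 := by
    rw [prod_filter, prod_filter, ← (Equiv.prodComm ι ι).prod_comp]
    simp [hK]
  have h3 : (univ.filter fun p : ι × ι => p.1 ≠ p.2)
      = (univ.filter fun p : ι × ι => p.1 < p.2) ∪ univ.filter fun p : ι × ι => p.2 < p.1 := by
    ext; simp
  rw [h1, h3, prod_union, h2, sq]
  exact disjoint_filter.2 fun _ _ h => h.le.not_gt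

/-- A product over the edges of a complete graph (on `ι` and one extra vertex) is at most the sum
over the vertices of suitable powers of the products over their stars. -/
lemma prod_mul_prod_lt_le_sum_star {ι : Type*} [Fintype ι] [LinearOrder ι] (H : ι → ℝ)
    (K : ι → ι → ℝ) (hH : ∀ i, 0 < H i) (hKpos : ∀ i j, i ≠ j → 0 < K i j)
    (hK : ∀ i j, K i j = K j i) {c : ℝ} (hc : c = (Fintype.card ι + 1) / 2) :
    (∏ i, H i) * ∏ p : ι × ι with p.1 < p.2, K p.1 p.2 ≤
      (∏ i, H i) ^ c + ∑ i, (H i * ∏ u ∈ univ.erase i, K u i) ^ c := by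
  set P := (∏ i, H i) * ∏ p : ι × ι with p.1 < p.2, K p.1 p.2 with hP
  have hA : 0 < ∏ i, H i := prod_pos fun i _ => hH i
  have hB : ∀ i, 0 < H i * ∏ u ∈ univ.erase i, K u i := fun i =>
    mul_pos (hH i) (prod_pos fun u hu => hKpos _ _ (ne_of_mem_erase hu))
  have hPpos : 0 < P := mul_pos hA (prod_pos fun p hp => hKpos _ _ (mem_filter.1 hp).2.ne)
  by_contra! hlt
  have hsum : ∀ i, (H i * ∏ u ∈ univ.erase i, K u i) ^ c
      ≤ ∑ i, (H i * ∏ u ∈ univ.erase i, K u i) ^ c := fun i =>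
    single_le_sum (f := fun i => (H i * ∏ u ∈ univ.erase i, K u i) ^ c)
      (fun i _ => Real.rpow_nonneg (hB i).le c) (mem_univ i)
  have hA' : (∏ i, H i) ^ c < P :=
    lt_of_le_of_lt (le_add_of_nonneg_right
      (sum_nonneg fun i _ => Real.rpow_nonneg (hB i).le c)) hlt
  have hB' : ∀ i, (H i * ∏ u ∈ univ.erase i, K u i) ^ c ≤ P := fun i => by
    linarith [hsum i, Real.rpow_pos_of_pos hA c]
  have hsq : P ^ 2 = (∏ i, H i) * ∏ i, (H i * ∏ u ∈ univ.erase i, K u i) := by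
    rw [prod_mul_distrib, prod_prod_erase_eq_sq K hK, hP]; ring
  have hle : (P ^ 2) ^ c < P * P ^ Fintype.card ι := by
    rw [hsq, Real.mul_rpow hA.le (prod_nonneg fun i _ => (hB i).le),
      ← Real.finsetProd_rpow _ _ fun i _ => (hB i).le]
    refine mul_lt_mul hA' ?_ (prod_pos fun i _ => Real.rpow_pos_of_pos (hB i) c) hPpos.le
    exact (prod_le_prod (fun i _ => Real.rpow_nonneg (hB i).le c) fun i _ => hB' i).trans_eq
      (by simp)
  have : (P ^ 2) ^ c = P * P ^ Fintype.card ι := by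
    rw [← pow_succ', ← Real.rpow_natCast, ← Real.rpow_mul hPpos.le, ← Real.rpow_natCast, hc]
    congr 1
    push_cast; ring
  exact hle.ne this

/-- The uniform Koba-Nielsen density of exponent `-β` is dominated by an integrable function on
every cube, away from the hyperplanes where it is singular. -/
lemma exists_integrable_bound_prod_abs_rpow_neg {ι : Type*} [Fintype ι] [LinearOrder ι]
    {β : ℝ} (hβ : 0 ≤ β) (hβ' : (Fintype.card ι + 1) / 2 * β < 1) (R : ℝ) :
    ∃ B : (ι → ℝ) → ℝ, Integrable B ∧ ∀ x, (∀ i, |x i| ≤ R) → (∀ i, x i ≠ 0) →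
      (∀ i, x i ≠ 1) → (∀ i j, i ≠ j → x i ≠ x j) →
      (∏ i, |x i| ^ (-β) * |1 - x i| ^ (-β)) *
        ∏ p : ι × ι with p.1 < p.2, |x p.1 - x p.2| ^ (-β) ≤ B x := by
  set c : ℝ := (Fintype.card ι + 1) / 2 with hc
  have hc0 : 0 ≤ c := by positivity
  set γ := c * β with hγ
  have hγ0 : 0 ≤ γ := mul_nonneg hc0 hβ
  set h : ℝ → ℝ := (Set.Icc (-R) R).indicator fun t => |t| ^ (-γ) * |1 - t| ^ (-γ) with hh
  set k : ℝ → ℝ := (Set.Icc (-(2 * R)) (2 * R)).indicator fun t => |t| ^ (-γ) with hk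
  have hhi : Integrable h := (integrable_indicator_iff measurableSet_Icc).2
    (integrableOn_abs_rpow_neg_mul_abs_one_sub_rpow_neg hγ0 hβ')
  have hki : Integrable k := (integrable_indicator_iff measurableSet_Icc).2
    (integrableOn_abs_rpow_neg hβ' _)
  refine ⟨fun x => ∏ i, h (x i) + ∑ i, ∏ u, (if u = i then h else k)
    (if u = i then x u else x u - x i), ?_, fun x hxR hx0 hx1 hxx => ?_⟩
  · refine Integrable.add (Integrable.fintype_prod fun _ => hhi)
      (integrable_finsetSum _ fun i _ => integrable_prod_shear i fun u => ?_)
    split_ifs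
    exacts [hhi, hki]
  have hpow : ∀ t : ℝ, (|t| ^ (-β)) ^ c = |t| ^ (-γ) := fun t => by
    rw [← Real.rpow_mul (abs_nonneg t), hγ]; ring_nf
  have hhx : ∀ i, (|x i| ^ (-β) * |1 - x i| ^ (-β)) ^ c = h (x i) := fun i => by
    rw [Real.mul_rpow (by positivity) (by positivity), hpow, hpow, hh,
      Set.indicator_of_mem (Set.mem_Icc.2 (abs_le.1 (hxR i)))]
  have hkx : ∀ u i, (|x u - x i| ^ (-β)) ^ c = k (x u - x i) := fun u i => by
    have : |x u - x i| ≤ 2 * R := by linarith [abs_sub (x u) (x i), hxR u, hxR i]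
    rw [hpow, hk, Set.indicator_of_mem (Set.mem_Icc.2 (abs_le.1 this))]
  refine (prod_mul_prod_lt_le_sum_star (fun i => |x i| ^ (-β) * |1 - x i| ^ (-β))
    (fun i j => |x i - x j| ^ (-β)) (fun i => ?_) (fun i j hij => ?_) (fun i j => ?_) hc).trans_eq
    ?_
  · exact mul_pos (Real.rpow_pos_of_pos (abs_pos.2 (hx0 i)) _)
      (Real.rpow_pos_of_pos (abs_pos.2 (sub_ne_zero.2 (hx1 i).symm)) _)
  · exact Real.rpow_pos_of_pos (abs_pos.2 (sub_ne_zero.2 (hxx i j hij))) _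
  · rw [abs_sub_comm]
  congr 1
  · rw [← Real.finsetProd_rpow _ _ fun i _ => by positivity]
    exact prod_congr rfl fun i _ => hhx i
  · refine sum_congr rfl fun i _ => ?_
    rw [Real.mul_rpow (by positivity) (prod_nonneg fun u _ => by positivity),
      ← Real.finsetProd_rpow _ _ fun u _ => by positivity, hhx i,
      ← mul_prod_erase univ _ (mem_univ i)]
    simp only [if_true]
    congr 1
    refine prod_congr rfl fun u hu => ?_
    simp only [ne_of_mem_erase hu, if_false, hkx]

lemma norm_ofReal_abs_cpow_le {t T β M : ℝ} {a : ℂ} (ht : t ≠ 0) (htT : |t| ≤ T) (hT : 1 ≤ T)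
    (hβ : -β < a.re) (hM : a.re ≤ M) :
    ‖((|t| : ℝ) : ℂ) ^ a‖ ≤ T ^ (M + β) * |t| ^ (-β) := by
  have ht' : 0 < |t| := abs_pos.2 ht
  rw [Complex.norm_cpow_eq_rpow_re_of_pos ht',
    show a.re = (a.re + β) + -β by ring, Real.rpow_add ht']
  gcongr
  calc |t| ^ (a.re + β) ≤ T ^ (a.re + β) := by gcongr; linarith
    _ ≤ T ^ (M + β) := by gcongr

lemma ae_forall_ne_and_injective {ι : Type*} [Fintype ι] :
    ∀ᵐ x : ι → ℝ, (∀ i, x i ≠ 0) ∧ (∀ i, x i ≠ 1) ∧ ∀ i j, i ≠ j → x i ≠ x j := by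
  classical
  refine (ae_all_iff.2 fun i => Measure.ae_eval_ne _ i 0).and
    ((ae_all_iff.2 fun i => Measure.ae_eval_ne _ i 1).and
      (ae_all_iff.2 fun i => ae_all_iff.2 fun j => ?_))
  by_cases hij : i = j
  · simp [hij]
  let s : Submodule ℝ (ι → ℝ) :=
    LinearMap.ker (LinearMap.proj (R := ℝ) (φ := fun _ : ι => ℝ) i - LinearMap.proj j)
  have hs : s ≠ ⊤ := fun h => by
    have : Pi.single i (1 : ℝ) ∈ s := h ▸ Submodule.mem_top
    simp [s, Ne.symm hij] at this
  refine (measure_eq_zero_iff_ae_notMem.1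
    (Measure.addHaar_submodule (volume : Measure (ι → ℝ)) s hs)).mono fun x hx _ hxx => hx ?_
  simp [s, hxx]

/-- An integral depending holomorphically on a parameter is complex differentiable in it if the
integrand is locally bounded, uniformly in the parameter, by an integrable function. -/
lemma differentiableAt_integral_of_norm_le {α E : Type*} [MeasurableSpace α] {μ : Measure α}
    [NormedAddCommGroup E] [NormedSpace ℂ E] {F : E → α → ℂ} {F' : α → E →L[ℂ] ℂ} {B : α → ℝ}
    {s₀ : E} {r : ℝ} (hr : 0 < r) (hF : ∀ s, AEStronglyMeasurable (F s) μ)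
    (hF' : AEStronglyMeasurable F' μ) (hB : Integrable B μ)
    (hle : ∀ᵐ x ∂μ, ∀ s ∈ Metric.ball s₀ r, ‖F s x‖ ≤ B x)
    (hd : ∀ᵐ x ∂μ, Differentiable ℂ (F · x))
    (hd' : ∀ᵐ x ∂μ, HasFDerivAt (F · x) (F' x) s₀) :
    DifferentiableAt ℂ (fun s => ∫ x, F s x ∂μ) s₀ := by
  refine (hasFDerivAt_integral_of_dominated_loc_of_lip' (𝕜 := ℂ)
    (bound := fun x => 2 * B x / r) (Metric.ball_mem_nhds s₀ hr)
    (fun s _ => hF s) (hB.mono' (hF s₀) ?_) hF' ?_ ((hB.const_mul 2).div_const r)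
    hd').2.differentiableAt
  · exact hle.mono fun x hx => hx s₀ (Metric.mem_ball_self hr)
  · filter_upwards [hle, hd] with x hx hdx s hs
    have := Complex.dist_le_div_mul_dist_of_mapsTo_ball (f := (F · x)) (R₂ := 2 * B x)
      hdx.differentiableOn (fun z hz => ?_) hs
    · simpa [dist_eq_norm] using this
    · rw [Metric.mem_closedBall, dist_eq_norm]
      linarith [norm_sub_le (F z x) (F s₀ x), hx z hz, hx s₀ (Metric.mem_ball_self hr)]

lemma eventually_nhds_mem_KNregionLower {N : ℕ} {lo : ℝ}
    {s : (Fin (N - 3) → ℂ) × (Fin (N - 3) → ℂ) × (Fin (N - 3) → Fin (N - 3) → ℂ)}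
    (hs : s ∈ KNregionLower N lo) : ∀ᶠ s' in nhds s, s' ∈ KNregionLower N lo := by
  refine (Filter.eventually_all.2 fun j => ?_).and ((Filter.eventually_all.2 fun j => ?_).and
    (Filter.eventually_all.2 fun i => Filter.eventually_all.2 fun j =>
      Filter.eventually_imp_distrib_left.2 fun hij => ?_))
  · exact ContinuousAt.eventually_lt (by fun_prop) (by fun_prop) (hs.1 j)
  · exact ContinuousAt.eventually_lt (by fun_prop) (by fun_prop) (hs.2.1 j)
  · exact ContinuousAt.eventually_lt (by fun_prop) (by fun_prop) (hs.2.2 i j hij)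

lemma eventually_nhdsGT_mem_KNregionLower {N : ℕ} {lo : ℝ}
    {s : (Fin (N - 3) → ℂ) × (Fin (N - 3) → ℂ) × (Fin (N - 3) → Fin (N - 3) → ℂ)}
    (hs : s ∈ KNregionLower N lo) : ∀ᶠ lo' in nhdsWithin lo (Set.Ioi lo),
      s ∈ KNregionLower N lo' := by
  refine Filter.Eventually.filter_mono nhdsWithin_le_nhds
    ((Filter.eventually_all.2 fun j => ?_).and ((Filter.eventually_all.2 fun j => ?_).and
    (Filter.eventually_all.2 fun i => Filter.eventually_all.2 fun j =>
      Filter.eventually_imp_distrib_left.2 fun hij => ?_)))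
  · exact eventually_lt_nhds (hs.1 j)
  · exact eventually_lt_nhds (hs.2.1 j)
  · exact eventually_lt_nhds (hs.2.2 i j hij)

lemma norm_KNintegrand_le {N : ℕ} {β M T : ℝ} (hT : 1 ≤ T)
    {s : (Fin (N - 3) → ℂ) × (Fin (N - 3) → ℂ) × (Fin (N - 3) → Fin (N - 3) → ℂ)}
    (hs : s ∈ KNregionLower N (-β)) (hM : ‖s‖ ≤ M) {x : Fin (N - 3) → ℝ}
    (hxT : ∀ i, |x i| ≤ T) (hxT' : ∀ i, |1 - x i| ≤ T) (hxT'' : ∀ i j, |x i - x j| ≤ T)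
    (hx0 : ∀ i, x i ≠ 0) (hx1 : ∀ i, x i ≠ 1) (hxx : ∀ i j, i ≠ j → x i ≠ x j) :
    ‖KNintegrand N s.1 s.2.1 s.2.2 x‖ ≤
      (∏ _i : Fin (N - 3), T ^ (M + β)) * (∏ _i : Fin (N - 3), T ^ (M + β)) *
        (∏ p : Fin (N - 3) × Fin (N - 3) with p.1 < p.2, T ^ (M + β)) *
      ((∏ i, |x i| ^ (-β) * |1 - x i| ^ (-β)) *
        ∏ p : Fin (N - 3) × Fin (N - 3) with p.1 < p.2, |x p.1 - x p.2| ^ (-β)) := by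
  have ha : ∀ i, (s.1 i).re ≤ M := fun i => (Complex.re_le_norm _).trans
    ((norm_le_pi_norm s.1 i).trans ((norm_fst_le s).trans hM))
  have hb : ∀ i, (s.2.1 i).re ≤ M := fun i => (Complex.re_le_norm _).trans
    ((norm_le_pi_norm s.2.1 i).trans ((norm_fst_le s.2).trans ((norm_snd_le s).trans hM)))
  have hc : ∀ i j, (s.2.2 i j).re ≤ M := fun i j => (Complex.re_le_norm _).trans
    ((norm_le_pi_norm (s.2.2 i) j).trans ((norm_le_pi_norm s.2.2 i).trans
      ((norm_snd_le s.2).trans ((norm_snd_le s).trans hM))))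
  calc ‖KNintegrand N s.1 s.2.1 s.2.2 x‖
      = (∏ j, ‖((|x j| : ℝ) : ℂ) ^ s.1 j‖) * (∏ j, ‖((|1 - x j| : ℝ) : ℂ) ^ s.2.1 j‖) *
        ∏ p : Fin (N - 3) × Fin (N - 3) with p.1 < p.2,
          ‖((|x p.1 - x p.2| : ℝ) : ℂ) ^ s.2.2 p.1 p.2‖ := by
        simp only [KNintegrand, norm_mul, norm_prod]
    _ ≤ (∏ j, T ^ (M + β) * |x j| ^ (-β)) * (∏ j, T ^ (M + β) * |1 - x j| ^ (-β)) *
        ∏ p : Fin (N - 3) × Fin (N - 3) with p.1 < p.2,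
          T ^ (M + β) * |x p.1 - x p.2| ^ (-β) := by
        gcongr with j _ j _ p hp
        · exact norm_ofReal_abs_cpow_le (hx0 j) (hxT j) hT (hs.1 j) (ha j)
        · exact norm_ofReal_abs_cpow_le (sub_ne_zero.2 (hx1 j).symm) (hxT' j) hT (hs.2.1 j) (hb j)
        · have hp' := (mem_filter.1 hp).2
          exact norm_ofReal_abs_cpow_le (sub_ne_zero.2 (hxx _ _ hp'.ne)) (hxT'' _ _) hT
            (hs.2.2 _ _ hp') (hc _ _)
    _ = _ := by
        simp only [prod_mul_distrib]
        ring

/-- Near every point of the region of convergence, the integrand of the localized zeta function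
is bounded by an integrable function, uniformly in the parameters. -/
lemma exists_ball_forall_norm_mul_KNintegrand_le {N : ℕ} (hN : 4 ≤ N)
    {Θ : (Fin (N - 3) → ℝ) → ℂ} (hΘ : Continuous Θ) (hΘc : HasCompactSupport Θ)
    {s₀ : (Fin (N - 3) → ℂ) × (Fin (N - 3) → ℂ) × (Fin (N - 3) → Fin (N - 3) → ℂ)}
    (hs₀ : s₀ ∈ KNregionLower N (-2 / ((N : ℝ) - 2))) :
    ∃ r > 0, ∃ B : (Fin (N - 3) → ℝ) → ℝ, Integrable B ∧
      ∀ᵐ x, ∀ s ∈ Metric.ball s₀ r, ‖Θ x * KNintegrand N s.1 s.2.1 s.2.2 x‖ ≤ B x := by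
  have hN' : (0 : ℝ) < (N : ℝ) - 2 := by
    have : (4 : ℝ) ≤ N := by exact_mod_cast hN
    linarith
  have hneg : -2 / ((N : ℝ) - 2) < 0 := div_neg_of_neg_of_pos (by norm_num) hN'
  obtain ⟨lo, hlo, hlo0, hlos⟩ := ((eventually_nhdsGT_mem_KNregionLower hs₀).and
    ((Filter.Eventually.filter_mono nhdsWithin_le_nhds (eventually_lt_nhds hneg)).and
      self_mem_nhdsWithin)).exists
  obtain ⟨β, rfl⟩ : ∃ β, lo = -β := ⟨-lo, by simp⟩
  have hlos' : -2 / ((N : ℝ) - 2) < -β := hlos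
  have hβ : ((Fintype.card (Fin (N - 3)) : ℝ) + 1) / 2 * β < 1 := by
    rw [div_lt_iff₀ hN'] at hlos'
    rw [Fintype.card_fin, Nat.cast_sub (by omega)]
    push_cast
    linarith
  obtain ⟨r, hr, hball⟩ := Metric.eventually_nhds_iff_ball.1 (eventually_nhds_mem_KNregionLower hlo)
  obtain ⟨R, hR⟩ := hΘc.isCompact.isBounded.exists_norm_le
  obtain ⟨D, hD⟩ := hΘc.exists_bound_of_continuous hΘ
  obtain ⟨B, hBi, hB⟩ := exists_integrable_bound_prod_abs_rpow_neg (ι := Fin (N - 3))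
    (β := β) (by linarith) hβ R
  set T := 2 * |R| + 1 with hT
  have hT1 : 1 ≤ T := by linarith [abs_nonneg R]
  set C := (∏ _i : Fin (N - 3), T ^ (‖s₀‖ + r + β)) * (∏ _i : Fin (N - 3), T ^ (‖s₀‖ + r + β)) *
    (∏ p : Fin (N - 3) × Fin (N - 3) with p.1 < p.2, T ^ (‖s₀‖ + r + β))
  have hC0 : 0 ≤ C := by positivity
  refine ⟨r, hr, fun x => D * (C * |B x|), (hBi.abs.const_mul C).const_mul D, ?_⟩
  filter_upwards [ae_forall_ne_and_injective] with x ⟨hx0, hx1, hxx⟩ s hs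
  have hD0 : 0 ≤ D := (norm_nonneg _).trans (hD x)
  by_cases hx : Θ x = 0
  · rw [hx, zero_mul, norm_zero]
    positivity
  have hxR : ∀ i, |x i| ≤ R := fun i =>
    (norm_le_pi_norm x i).trans (hR x (subset_tsupport _ hx))
  have hRR : R ≤ |R| := le_abs_self R
  have hsM : ‖s‖ ≤ ‖s₀‖ + r := by
    have := norm_le_norm_add_norm_sub' s s₀
    rw [Metric.mem_ball, dist_eq_norm] at hs
    linarith
  rw [norm_mul]
  gcongr
  · exact hD x
  refine (norm_KNintegrand_le hT1 (hball s hs) hsM (fun i => ?_) (fun i => ?_) (fun i j => ?_)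
    hx0 hx1 hxx).trans ?_
  · linarith [hxR i, abs_nonneg (x i)]
  · linarith [hxR i, abs_sub 1 (x i), abs_nonneg (x i), abs_one (α := ℝ)]
  · linarith [hxR i, hxR j, abs_sub (x i) (x j)]
  · exact mul_le_mul_of_nonneg_left ((hB x hxR hx0 hx1 hxx).trans (le_abs_self _)) hC0

lemma measurable_KNintegrand (N : ℕ) (a b : Fin (N - 3) → ℂ)
    (c : Fin (N - 3) → Fin (N - 3) → ℂ) : Measurable (KNintegrand N a b c) := by
  unfold KNintegrand
  fun_prop

/-- The logarithm of the Koba-Nielsen integrand, as a linear form in the exponents. -/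
noncomputable def logKNintegrand (N : ℕ) (x : Fin (N - 3) → ℝ) :
    (Fin (N - 3) → ℂ) × (Fin (N - 3) → ℂ) × (Fin (N - 3) → Fin (N - 3) → ℂ) →L[ℂ] ℂ :=
  (∑ j, ((Real.log |x j| : ℝ) : ℂ) •
      (ContinuousLinearMap.proj j ∘L ContinuousLinearMap.fst ℂ _ _)) +
    (∑ j, ((Real.log |1 - x j| : ℝ) : ℂ) • (ContinuousLinearMap.proj j ∘L
      ContinuousLinearMap.fst ℂ _ _ ∘L ContinuousLinearMap.snd ℂ _ _)) +
    ∑ p : Fin (N - 3) × Fin (N - 3) with p.1 < p.2, ((Real.log |x p.1 - x p.2| : ℝ) : ℂ) •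
      (ContinuousLinearMap.proj (R := ℂ) (φ := fun _ : Fin (N - 3) => ℂ) p.2 ∘L
        ContinuousLinearMap.proj (R := ℂ) (φ := fun _ : Fin (N - 3) => Fin (N - 3) → ℂ) p.1 ∘L
        ContinuousLinearMap.snd ℂ _ _ ∘L ContinuousLinearMap.snd ℂ _ _)

lemma measurable_logKNintegrand (N : ℕ) : Measurable (logKNintegrand N) := by
  unfold logKNintegrand
  fun_prop

lemma KNintegrand_eq_exp {N : ℕ} {x : Fin (N - 3) → ℝ} (hx0 : ∀ i, x i ≠ 0)
    (hx1 : ∀ i, x i ≠ 1) (hxx : ∀ i j, i ≠ j → x i ≠ x j)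
    (s : (Fin (N - 3) → ℂ) × (Fin (N - 3) → ℂ) × (Fin (N - 3) → Fin (N - 3) → ℂ)) :
    KNintegrand N s.1 s.2.1 s.2.2 x = Complex.exp (logKNintegrand N x s) := by
  have key : ∀ (t : ℝ) (a : ℂ), t ≠ 0 →
      ((|t| : ℝ) : ℂ) ^ a = Complex.exp ((Real.log |t| : ℝ) * a) := fun t a ht => by
    rw [Complex.cpow_def_of_ne_zero (by simpa using ht), Complex.ofReal_log (abs_nonneg t)]
  simp only [logKNintegrand, _root_.add_apply, _root_.sum_apply, _root_.smul_apply,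
    ContinuousLinearMap.comp_apply, ContinuousLinearMap.proj_apply,
    ContinuousLinearMap.coe_fst', ContinuousLinearMap.coe_snd', smul_eq_mul, Complex.exp_add,
    Complex.exp_sum, KNintegrand]
  congr 1
  · congr 1
    · exact prod_congr rfl fun j _ => key _ _ (hx0 j)
    · exact prod_congr rfl fun j _ => key _ _ (sub_ne_zero.2 (hx1 j).symm)
  · exact prod_congr rfl fun p hp => key _ _ (sub_ne_zero.2 (hxx _ _ (mem_filter.1 hp).2.ne))

/-- For `N ≥ 4` and a smooth, compactly supported test function `Θ : ℝ^{N-3} → ℂ`, the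
localized Koba-Nielsen zeta function `Z_Θ^(N)(s)` converges absolutely and is holomorphic
in `s` on the open set where `Re(s_{ij}) > -2/(N-2)` for every index pair `ij`. -/
theorem kobaNielsen_test_function_convergent_and_holomorphic (N : ℕ) (hN : 4 ≤ N)
    (Θ : (Fin (N - 3) → ℝ) → ℂ) (hΘ : ContDiff ℝ (⊤ : ℕ∞) Θ) (hΘc : HasCompactSupport Θ) :
    (∀ s ∈ KNregionLower N (-2 / ((N : ℝ) - 2)),
      Integrable (fun x => Θ x * KNintegrand N s.1 s.2.1 s.2.2 x)) ∧
    DifferentiableOn ℂ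
      (fun s : (Fin (N - 3) → ℂ) × (Fin (N - 3) → ℂ) × (Fin (N - 3) → Fin (N - 3) → ℂ) =>
        ∫ x, Θ x * KNintegrand N s.1 s.2.1 s.2.2 x)
      (KNregionLower N (-2 / ((N : ℝ) - 2))) := by
  have hmeas : ∀ s : (Fin (N - 3) → ℂ) × (Fin (N - 3) → ℂ) × (Fin (N - 3) → Fin (N - 3) → ℂ),
      AEStronglyMeasurable (fun x => Θ x * KNintegrand N s.1 s.2.1 s.2.2 x) := fun s =>
    (hΘ.continuous.measurable.mul (measurable_KNintegrand N _ _ _)).aestronglyMeasurable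
  refine ⟨fun s hs => ?_, fun s hs => DifferentiableAt.differentiableWithinAt ?_⟩
  · obtain ⟨r, hr, B, hBi, hB⟩ :=
      exists_ball_forall_norm_mul_KNintegrand_le hN hΘ.continuous hΘc hs
    exact hBi.mono' (hmeas s) (hB.mono fun x hx => hx s (Metric.mem_ball_self hr))
  obtain ⟨r, hr, B, hBi, hB⟩ :=
    exists_ball_forall_norm_mul_KNintegrand_le hN hΘ.continuous hΘc hs
  have hderiv : ∀ᵐ x : Fin (N - 3) → ℝ, ∀ s' : (Fin (N - 3) → ℂ) × (Fin (N - 3) → ℂ) ×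
      (Fin (N - 3) → Fin (N - 3) → ℂ),
      HasFDerivAt (fun s => Θ x * KNintegrand N s.1 s.2.1 s.2.2 x)
        ((Θ x * KNintegrand N s'.1 s'.2.1 s'.2.2 x) • logKNintegrand N x) s' := by
    filter_upwards [ae_forall_ne_and_injective] with x ⟨hx0, hx1, hxx⟩ s'
    simp only [KNintegrand_eq_exp hx0 hx1 hxx, mul_smul]
    exact (logKNintegrand N x).hasFDerivAt.cexp.const_mul (Θ x)
  refine differentiableAt_integral_of_norm_le
    (F' := fun x => (Θ x * KNintegrand N s.1 s.2.1 s.2.2 x) • logKNintegrand N x) hr hmeas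
    ((hmeas s).smul (measurable_logKNintegrand N).aestronglyMeasurable) hBi hB
    (hderiv.mono fun x hx s' => (hx s').differentiableAt) (hderiv.mono fun x hx => hx s)
end

section
/- Let N ≥ 4 be an integer, let ε > 0, and let χ : ℝ → ℝ be a smooth function with χ(x) = 1 for x ∈ [−2,2] and χ(x) = 0 for |x| ≥ 2 + ε. Let I be a proper subset of {2,…,N−2} (possibly empty), and set φ_I(x) = ∏_{i∈I} χ(x_i) · ∏_{i∉I} (1 − χ(x_i)). Then the integral Z_I^(N)(s) = ∫_{ℝ^{N-3}} φ_I(x) ∏_{j=2}^{N-2} |x_j|^{s_{1j}} |1−x_j|^{s_{(N-1)j}} ∏_{2≤i<j≤N-2} |x_i−x_j|^{s_{ij}} ∏ dx_i converges absolutely and defines a holomorphic function of s = (s_{ij}) ∈ ℂ^{N(N-3)/2} on the open set where −2/(N−2) < Re(s_{ij}) < −2/N for every index pair ij. -/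
open MeasureTheory Finset

/-- The cut-off function `φ_I(x) = ∏_{i∈I} χ(x_i) · ∏_{i∉I} (1 - χ(x_i))` from the
partition of unity, where `I ⊆ {2,…,N-2}` is modelled as a `Finset (Fin (N-3))`. -/
def phiI (N : ℕ) (χ : ℝ → ℝ) (I : Finset (Fin (N - 3))) (x : Fin (N - 3) → ℝ) : ℝ :=
  (∏ i ∈ I, χ (x i)) * ∏ i ∈ Iᶜ, (1 - χ (x i))

/-- The open band `lo < Re(s_{ij}) < hi` for all relevant index pairs `ij`. -/
def KNregion (N : ℕ) (lo hi : ℝ) :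
    Set ((Fin (N - 3) → ℂ) × (Fin (N - 3) → ℂ) × (Fin (N - 3) → Fin (N - 3) → ℂ)) :=
  {s | (∀ j, lo < (s.1 j).re ∧ (s.1 j).re < hi) ∧
       (∀ j, lo < (s.2.1 j).re ∧ (s.2.1 j).re < hi) ∧
       (∀ i j, i < j → lo < (s.2.2 i j).re ∧ (s.2.2 i j).re < hi)}

theorem sum_filter_lt_eq_sum_range (n : ℕ) (G : ℕ → ℕ → ℝ) :
    ∑ p ∈ univ.filter (fun p : Fin n × Fin n => p.1 < p.2), G p.1 p.2 =
      ∑ j ∈ range n, ∑ i ∈ range j, G i j := by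
  rw [Finset.sum_filter, Fintype.sum_prod_type_right, Finset.sum_range]
  refine Finset.sum_congr rfl fun j _ => ?_
  have h : range (j : ℕ) = (range n).filter (fun i => i < (j : ℕ)) := by
    ext i
    simp only [mem_range, mem_filter]
    have := j.2
    omega
  rw [h, Finset.sum_filter, Finset.sum_range]
  rfl

theorem two_mul_sum_filter_lt {n : ℕ} (S : Fin n → Fin n → ℝ) (hS : ∀ i j, S i j = S j i) :
    2 * ∑ p ∈ univ.filter (fun p : Fin n × Fin n => p.1 < p.2), S p.1 p.2 =
      ∑ i, ∑ j, if i = j then 0 else S i j := by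
  rw [Finset.sum_filter, two_mul]
  nth_rewrite 1 [Fintype.sum_prod_type]
  rw [Fintype.sum_prod_type_right, ← Finset.sum_add_distrib]
  refine Finset.sum_congr rfl fun i _ => ?_
  rw [← Finset.sum_add_distrib]
  refine Finset.sum_congr rfl fun j _ => ?_
  rcases lt_trichotomy i j with h | h | h
  · simp [h, h.ne, h.not_gt]
  · simp [h]
  · simp [h, h.ne', h.not_gt, hS i j]

theorem sum_filter_lt_comp_perm {n : ℕ} (S : Fin n → Fin n → ℝ) (hS : ∀ i j, S i j = S j i)
    (σ : Equiv.Perm (Fin n)) :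
    ∑ p ∈ univ.filter (fun p : Fin n × Fin n => p.1 < p.2), S (σ p.1) (σ p.2) =
      ∑ p ∈ univ.filter (fun p : Fin n × Fin n => p.1 < p.2), S p.1 p.2 := by
  have h1 := two_mul_sum_filter_lt S hS
  have h2 := two_mul_sum_filter_lt (fun i j => S (σ i) (σ j)) (fun i j => hS _ _)
  have h3 : (∑ i, ∑ j, if i = j then 0 else S (σ i) (σ j)) =
      ∑ i, ∑ j, if i = j then 0 else S i j := by
    rw [← Equiv.sum_comp σ (fun i => ∑ j, if i = j then 0 else S i j)]
    refine Finset.sum_congr rfl fun i _ => ?_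
    rw [← Equiv.sum_comp σ (fun j => if σ i = j then 0 else S (σ i) j)]
    simp
  linarith

theorem sum_range_sum_range_succ_add (n : ℕ) (F : ℕ → ℝ) :
    ∑ j ∈ range n, ∑ i ∈ range j, (F (i + 1) + F j) =
      n * ∑ k ∈ range n, F k - n * F 0 := by
  induction n with
  | zero => simp
  | succ n ih =>
    have h := Finset.sum_range_succ' F n
    have h' := Finset.sum_range_succ F n
    rw [Finset.sum_range_succ, ih, Finset.sum_add_distrib, h', Finset.sum_const, card_range,
      nsmul_eq_mul]
    push_cast
    linarith

/-- The distance from `z` to the set consisting of `0`, `1` and the points `y i` with `i < k`. -/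
noncomputable def distTo {n : ℕ} (y : Fin n → ℝ) (k : Fin n) (z : ℝ) : ℝ :=
  univ.inf' ⟨k, mem_univ k⟩
    (fun i => if i < k then min (min |z| |1 - z|) |z - y i| else min |z| |1 - z|)

theorem distTo_le_root {n : ℕ} (y : Fin n → ℝ) (k : Fin n) (z : ℝ) :
    distTo y k z ≤ min |z| |1 - z| :=
  (Finset.inf'_le _ (mem_univ k)).trans (by simp)

theorem distTo_le_abs_sub {n : ℕ} (y : Fin n → ℝ) {i k : Fin n} (h : i < k) (z : ℝ) :
    distTo y k z ≤ |z - y i| :=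
  (Finset.inf'_le _ (mem_univ i)).trans (by simp [h])

theorem distTo_congr {n : ℕ} {y y' : Fin n → ℝ} {k : Fin n} (h : ∀ i < k, y i = y' i) (z : ℝ) :
    distTo y k z = distTo y' k z := by
  unfold distTo
  refine Finset.inf'_congr _ rfl fun i _ => ?_
  split_ifs with hi
  · rw [h i hi]
  · rfl

theorem distTo_eq {n : ℕ} (y : Fin n → ℝ) (k : Fin n) (z : ℝ) :
    distTo y k z = |z| ∨ distTo y k z = |1 - z| ∨ ∃ i < k, distTo y k z = |z - y i| := by
  obtain ⟨i, -, hi⟩ := Finset.exists_mem_eq_inf' (⟨k, mem_univ k⟩ : (univ : Finset (Fin n)).Nonempty)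
    (fun i => if i < k then min (min |z| |1 - z|) |z - y i| else min |z| |1 - z|)
  change distTo y k z = _ at hi
  rw [hi]
  split_ifs with h
  · rcases min_choice (min |z| |1 - z|) |z - y i| with h1 | h1 <;> rw [h1]
    · rcases min_choice |z| |1 - z| with h2 | h2 <;> rw [h2] <;> simp
    · exact Or.inr (Or.inr ⟨i, h, rfl⟩)
  · rcases min_choice |z| |1 - z| with h2 | h2 <;> rw [h2] <;> simp

/-- Any finite family of points can be reordered greedily: each point is, among the remaining
ones, a closest one to `0`, `1` and the previous points. -/
theorem exists_perm_distTo_le {n : ℕ} (x : Fin n → ℝ) :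
    ∃ σ : Equiv.Perm (Fin n), ∀ k j, k ≤ j →
      distTo (x ∘ σ) k (x (σ k)) ≤ distTo (x ∘ σ) k (x (σ j)) := by
  suffices H : ∀ K : ℕ, ∃ σ : Equiv.Perm (Fin n), ∀ k j : Fin n, (k : ℕ) < K → k ≤ j →
      distTo (x ∘ σ) k (x (σ k)) ≤ distTo (x ∘ σ) k (x (σ j)) by
    obtain ⟨σ, hσ⟩ := H n
    exact ⟨σ, fun k j => hσ k j k.2⟩
  intro K
  induction K with
  | zero => exact ⟨1, fun k j hk => absurd hk (Nat.not_lt_zero _)⟩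
  | succ K ih =>
    obtain ⟨σ, hσ⟩ := ih
    by_cases hK : K < n
    swap
    · exact ⟨σ, fun k j _ => hσ k j (by have := k.2; omega)⟩
    set κ : Fin n := ⟨K, hK⟩ with hκ
    obtain ⟨m, hm, hmin⟩ := Finset.exists_min_image (univ.filter (fun j => κ ≤ j))
      (fun j => distTo (x ∘ σ) κ (x (σ j))) ⟨κ, by simp⟩
    simp only [mem_filter, mem_univ, true_and] at hm hmin
    have hfix : ∀ i, i < κ → Equiv.swap κ m i = i := fun i hi =>
      Equiv.swap_apply_of_ne_of_ne hi.ne (hi.trans_le hm).ne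
    have hge : ∀ k j, k ≤ κ → k ≤ j → k ≤ Equiv.swap κ m j := by
      intro k j hk hj
      rcases eq_or_ne j κ with rfl | h1
      · rw [Equiv.swap_apply_left]; exact hk.trans hm
      rcases eq_or_ne j m with rfl | h2
      · rw [Equiv.swap_apply_right]; exact hk
      · rwa [Equiv.swap_apply_of_ne_of_ne h1 h2]
    refine ⟨(Equiv.swap κ m).trans σ, fun k j hk hj => ?_⟩
    have hkκ : k ≤ κ := by
      rw [Fin.le_def]; exact Nat.lt_succ_iff.mp hk
    have hcong : ∀ z, distTo (x ∘ (Equiv.swap κ m).trans σ) k z = distTo (x ∘ σ) k z := by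
      refine distTo_congr fun i hi => ?_
      simp [hfix i (hi.trans_le hkκ)]
    rw [hcong, hcong]
    simp only [Equiv.trans_apply]
    rcases hkκ.lt_or_eq with h | h
    · rw [hfix k h]
      exact hσ k _ h (hge k j hkκ hj)
    · subst h
      rw [Equiv.swap_apply_left]
      exact hmin _ (hge _ j le_rfl hj)

/-- The function equal to `-a * log |t|` for `|t| ≤ 1` and to `-b * log |t|` for `1 ≤ |t|`. -/
noncomputable def logWeight (a b t : ℝ) : ℝ := a * Real.posLog t⁻¹ - b * Real.posLog t

theorem logWeight_neg (a b t : ℝ) : logWeight a b (-t) = logWeight a b t := by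
  simp [logWeight, inv_neg]

theorem logWeight_abs (a b t : ℝ) : logWeight a b |t| = logWeight a b t := by
  simp [logWeight, ← abs_inv]

theorem mul_log_abs_le_logWeight {a b r : ℝ} (hr : -a ≤ r) (hr' : r ≤ -b) (t : ℝ) :
    r * Real.log |t| ≤ logWeight a b t := by
  rw [Real.log_abs, ← Real.posLog_sub_posLog_inv, logWeight]
  have h1 := Real.posLog_nonneg (x := t)
  have h2 := Real.posLog_nonneg (x := t⁻¹)
  nlinarith

theorem posLog_inv_le_posLog_inv {s t : ℝ} (hs : 0 < s) (hst : s ≤ t) :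
    Real.posLog t⁻¹ ≤ Real.posLog s⁻¹ :=
  Real.posLog_le_posLog (inv_nonneg.2 (hs.le.trans hst)) (inv_anti₀ hs hst)

theorem logWeight_anti {a b s t : ℝ} (ha : 0 ≤ a) (hb : 0 ≤ b) (hs : 0 < s) (hst : s ≤ t) :
    logWeight a b t ≤ logWeight a b s := by
  have h1 := mul_le_mul_of_nonneg_left (posLog_inv_le_posLog_inv hs hst) ha
  have h2 := mul_le_mul_of_nonneg_left (Real.posLog_le_posLog hs.le hst) hb
  unfold logWeight
  linarith

theorem logWeight_add_logWeight_one_sub_le {a b z d e : ℝ} (ha : 0 ≤ a) (hb : 0 ≤ b)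
    (hd : 0 < d) (he : 0 < e) (hdz : d ≤ min |z| |1 - z|) (hez : e ≤ min |z| |1 - z|) :
    logWeight a b z + logWeight a b (1 - z) ≤
      a * Real.log 2 + a * (Real.posLog d⁻¹ + Real.posLog e⁻¹) / 2 -
        b * (Real.posLog d + 3 * Real.posLog e) / 2 := by
  set m := min |z| |1 - z| with hm
  have hm0 : 0 < m := hd.trans_le hdz
  have hmax : m ≤ max |z| |1 - z| := min_le_max
  have hhalf : (2 : ℝ)⁻¹ ≤ max |z| |1 - z| := by
    by_contra! h
    have h1 := (le_max_left |z| |1 - z|).trans_lt h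
    have h2 := (le_max_right |z| |1 - z|).trans_lt h
    have h3 := abs_add_le z (1 - z)
    rw [add_sub_cancel, abs_one] at h3
    norm_num at h1 h2
    linarith
  have hsum : logWeight a b z + logWeight a b (1 - z) =
      logWeight a b m + logWeight a b (max |z| |1 - z|) := by
    rw [← logWeight_abs a b z, ← logWeight_abs a b (1 - z), hm]
    rcases le_total |z| |1 - z| with h | h
    · rw [min_eq_left h, max_eq_right h]
    · rw [min_eq_right h, max_eq_left h, add_comm]
  have hu : Real.posLog (max |z| |1 - z|)⁻¹ ≤ Real.log 2 := by
    have := posLog_inv_le_posLog_inv (by norm_num) hhalf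
    rwa [inv_inv, Real.posLog_eq_log (x := 2) (by norm_num)] at this
  have hv := Real.posLog_le_posLog hm0.le hmax
  have h1 := mul_le_mul_of_nonneg_left hu ha
  have h2 := mul_le_mul_of_nonneg_left hv hb
  have h3 := mul_le_mul_of_nonneg_left (posLog_inv_le_posLog_inv hd hdz) ha
  have h4 := mul_le_mul_of_nonneg_left (posLog_inv_le_posLog_inv he hez) ha
  have h5 := mul_le_mul_of_nonneg_left (Real.posLog_le_posLog hd.le hdz) hb
  have h6 := mul_le_mul_of_nonneg_left (Real.posLog_le_posLog he.le hez) hb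
  rw [hsum]
  unfold logWeight
  linarith

/-- The pointwise bound for greedily ordered points: the logarithm of the Koba-Nielsen integrand
is controlled by the distances of each point to `0`, `1` and the preceding points. -/
theorem sum_logWeight_le {n : ℕ} {a b : ℝ} (ha : 0 ≤ a) (hb : 0 ≤ b) (y : Fin n → ℝ)
    (h0 : ∀ j, y j ≠ 0) (h1 : ∀ j, 1 - y j ≠ 0) (hne : ∀ i j, i < j → y i - y j ≠ 0)
    (hy : ∀ k j, k ≤ j → distTo y k (y k) ≤ distTo y k (y j)) :
    ∑ j, (logWeight a b (y j) + logWeight a b (1 - y j)) +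
        ∑ p ∈ univ.filter (fun p : Fin n × Fin n => p.1 < p.2), logWeight a b (y p.1 - y p.2) ≤
      n * (a * Real.log 2) +
        ∑ k, logWeight (a * (n + 1) / 2) (b * (n + 3) / 2) (distTo y k (y k)) := by
  have hpos : ∀ k, 0 < distTo y k (y k) := by
    intro k
    rcases distTo_eq y k (y k) with h | h | ⟨i, hi, h⟩ <;> rw [h]
    · exact abs_pos.2 (h0 k)
    · exact abs_pos.2 (h1 k)
    · exact abs_pos.2 (fun h' => hne i k hi (by linarith))
  set D : ℕ → ℝ := fun k => if h : k < n then distTo y ⟨k, h⟩ (y ⟨k, h⟩) else 1 with hD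
  have hDfin : ∀ k : Fin n, D k = distTo y k (y k) := fun k => by simp [hD]
  set U : ℕ → ℝ := fun k => Real.posLog (D k)⁻¹ with hU
  set V : ℕ → ℝ := fun k => Real.posLog (D k) with hV
  set F : ℕ → ℝ := fun k => (a * U k - b * V k) / 2 with hF
  have hroot : ∑ j, (logWeight a b (y j) + logWeight a b (1 - y j)) ≤
      ∑ j ∈ range n, (a * Real.log 2 + a * (U 0 + U j) / 2 - b * (V 0 + 3 * V j) / 2) := by
    rw [Finset.sum_range]
    refine Finset.sum_le_sum fun j _ => ?_
    have hn : 0 < n := j.pos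
    have e0 : D 0 = distTo y ⟨0, hn⟩ (y ⟨0, hn⟩) := hDfin ⟨0, hn⟩
    simp only [hU, hV, hDfin j, e0]
    exact logWeight_add_logWeight_one_sub_le ha hb (hpos _) (hpos _)
      ((hy ⟨0, hn⟩ j (Fin.mk_le_of_le_val (Nat.zero_le _))).trans (distTo_le_root _ _ _))
      (distTo_le_root _ _ _)
  have hpair : ∑ p ∈ univ.filter (fun p : Fin n × Fin n => p.1 < p.2),
      logWeight a b (y p.1 - y p.2) ≤
      ∑ p ∈ univ.filter (fun p : Fin n × Fin n => p.1 < p.2),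
        (F ((p.1 : ℕ) + 1) + F p.2) := by
    refine Finset.sum_le_sum fun p hp => ?_
    obtain ⟨i, j⟩ := p
    simp only [mem_filter, mem_univ, true_and] at hp
    have hi : (i : ℕ) + 1 < n := lt_of_le_of_lt (Nat.succ_le_of_lt hp) j.2
    have e1 : D ((i : ℕ) + 1) = distTo y ⟨i + 1, hi⟩ (y ⟨i + 1, hi⟩) := hDfin ⟨i + 1, hi⟩
    have hsym : logWeight a b (y i - y j) = logWeight a b |y j - y i| := by
      rw [logWeight_abs, ← logWeight_neg, neg_sub]
    have b1 := logWeight_anti ha hb (hpos j) (distTo_le_abs_sub y hp (y j))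
    have b2 := logWeight_anti ha hb (hpos ⟨i + 1, hi⟩)
      ((hy ⟨i + 1, hi⟩ j (Fin.mk_le_of_le_val hp)).trans
        (distTo_le_abs_sub y (i := i) (Fin.lt_def.2 (Nat.lt_succ_self _)) (y j)))
    simp only [hF, hU, hV, hDfin j, e1, hsym]
    unfold logWeight at b1 b2 ⊢
    linarith
  rw [sum_filter_lt_eq_sum_range n (fun i j => F (i + 1) + F j),
    sum_range_sum_range_succ_add] at hpair
  have hfinal : ∑ k, logWeight (a * (n + 1) / 2) (b * (n + 3) / 2) (distTo y k (y k)) =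
      a * (n + 1) / 2 * ∑ k ∈ range n, U k - b * (n + 3) / 2 * ∑ k ∈ range n, V k := by
    rw [Finset.sum_range, Finset.sum_range, Finset.mul_sum, Finset.mul_sum,
      ← Finset.sum_sub_distrib]
    refine Finset.sum_congr rfl fun k _ => ?_
    simp only [hU, hV, hDfin k, logWeight]
  have hFsum : ∑ k ∈ range n, F k =
      a / 2 * ∑ k ∈ range n, U k - b / 2 * ∑ k ∈ range n, V k := by
    rw [Finset.mul_sum, Finset.mul_sum, ← Finset.sum_sub_distrib]
    exact Finset.sum_congr rfl fun k _ => by simp only [hF]; ring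
  have hrsum : ∑ j ∈ range n, (a * Real.log 2 + a * (U 0 + U j) / 2 - b * (V 0 + 3 * V j) / 2) =
      n * (a * Real.log 2 + a * U 0 / 2 - b * V 0 / 2) + a / 2 * ∑ k ∈ range n, U k -
        3 * b / 2 * ∑ k ∈ range n, V k := by
    rw [Finset.mul_sum, Finset.mul_sum, ← nsmul_eq_mul, ← card_range n, ← Finset.sum_const,
      card_range, ← Finset.sum_add_distrib, ← Finset.sum_sub_distrib]
    exact Finset.sum_congr rfl fun k _ => by ring
  rw [hfinal]
  rw [hrsum] at hroot
  rw [hFsum] at hpair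
  have hF0 : F 0 = (a * U 0 - b * V 0) / 2 := rfl
  rw [hF0] at hpair
  refine (add_le_add hroot hpair).trans (le_of_eq ?_)
  ring

/-- Iterated product of sums of kernels `exp (logWeight a b ·)` attached to the differences of
each coordinate with `0`, `1` and all preceding coordinates. -/
noncomputable def forestKernel (a b : ℝ) : (n : ℕ) → (Fin n → ℝ) → ℝ
  | 0, _ => 1
  | n + 1, y => forestKernel a b n (fun i => y i.castSucc) *
      (Real.exp (logWeight a b (y (Fin.last n))) + Real.exp (logWeight a b (1 - y (Fin.last n))) +
        ∑ i : Fin n, Real.exp (logWeight a b (y (Fin.last n) - y i.castSucc)))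

theorem forestKernel_nonneg (a b : ℝ) : ∀ (n : ℕ) (y : Fin n → ℝ), 0 ≤ forestKernel a b n y
  | 0, _ => zero_le_one
  | n + 1, y => mul_nonneg (forestKernel_nonneg a b n _) (by positivity)

theorem distTo_castSucc {n : ℕ} (y : Fin (n + 1) → ℝ) (k : Fin n) (z : ℝ) :
    distTo y k.castSucc z = distTo (fun i => y i.castSucc) k z := by
  unfold distTo
  apply le_antisymm
  · refine Finset.le_inf' _ _ fun i _ => ?_
    refine (Finset.inf'_le _ (mem_univ i.castSucc)).trans (le_of_eq ?_)
    simp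
  · refine Finset.le_inf' _ _ fun i _ => ?_
    induction i using Fin.lastCases with
    | last =>
      refine (Finset.inf'_le _ (mem_univ k)).trans (le_of_eq ?_)
      simp [Fin.le_last, not_lt]
    | cast i =>
      refine (Finset.inf'_le _ (mem_univ i)).trans (le_of_eq ?_)
      simp

theorem exp_sum_logWeight_distTo_le (a b : ℝ) : ∀ (n : ℕ) (y : Fin n → ℝ),
    Real.exp (∑ k, logWeight a b (distTo y k (y k))) ≤ forestKernel a b n y
  | 0, y => by simp [forestKernel]
  | n + 1, y => by
    rw [Fin.sum_univ_castSucc, Real.exp_add, forestKernel]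
    refine mul_le_mul ?_ ?_ (Real.exp_nonneg _) (forestKernel_nonneg _ _ _ _)
    · simp only [distTo_castSucc]
      exact exp_sum_logWeight_distTo_le a b n _
    · have hs : 0 ≤ ∑ i : Fin n, Real.exp (logWeight a b (y (Fin.last n) - y i.castSucc)) := by
        positivity
      have p1 := Real.exp_pos (logWeight a b (y (Fin.last n)))
      have p2 := Real.exp_pos (logWeight a b (1 - y (Fin.last n)))
      rcases distTo_eq y (Fin.last n) (y (Fin.last n)) with h | h | ⟨i, hi, h⟩ <;>
        rw [h, logWeight_abs]
      · linarith
      · linarith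
      · obtain ⟨i, rfl⟩ := Fin.exists_castSucc_eq.2 hi.ne
        have := Finset.single_le_sum (f := fun i : Fin n =>
          Real.exp (logWeight a b (y (Fin.last n) - y i.castSucc)))
          (fun i _ => Real.exp_nonneg _) (mem_univ i)
        linarith

theorem measurable_exp_logWeight (a b : ℝ) : Measurable fun t => Real.exp (logWeight a b t) := by
  unfold logWeight
  have h : Measurable Real.posLog := Real.continuous_posLog.measurable
  exact (((h.comp measurable_inv).const_mul a).sub (h.const_mul b)).exp

theorem integrable_exp_logWeight {a b : ℝ} (ha : a < 1) (hb : 1 < b) :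
    Integrable fun t => Real.exp (logWeight a b t) := by
  have h01 : IntegrableOn (fun t => Real.exp (logWeight a b t)) (Set.Ioc 0 1) := by
    have h := (intervalIntegral.intervalIntegrable_rpow' (a := 0) (b := 1)
      (by linarith : -1 < -a)).1
    refine h.congr_fun (fun t ht => ?_) measurableSet_Ioc
    dsimp only
    rw [logWeight, (Real.posLog_eq_zero_iff t).2 (by rw [abs_of_pos ht.1]; exact ht.2),
      Real.posLog_eq_log (x := t⁻¹)
        (by rw [abs_of_pos (inv_pos.2 ht.1)]; exact (one_le_inv₀ ht.1).2 ht.2),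
      Real.rpow_def_of_pos ht.1, Real.log_inv]
    ring_nf
  have h1 : IntegrableOn (fun t => Real.exp (logWeight a b t)) (Set.Ioi 1) := by
    have h := integrableOn_Ioi_rpow_of_lt (by linarith : -b < -1) zero_lt_one
    refine h.congr_fun (fun t ht => ?_) measurableSet_Ioi
    have ht0 : (0 : ℝ) < t := zero_lt_one.trans ht
    dsimp only
    rw [logWeight, (Real.posLog_eq_zero_iff t⁻¹).2
        (by rw [abs_of_pos (inv_pos.2 ht0)]; exact inv_le_one_of_one_le₀ (le_of_lt ht)),
      Real.posLog_eq_log (x := t) (by rw [abs_of_pos ht0]; exact le_of_lt ht),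
      Real.rpow_def_of_pos ht0]
    ring_nf
  have h0 : IntegrableOn (fun t => Real.exp (logWeight a b t)) (Set.Ioi 0) := by
    rw [← Set.Ioc_union_Ioi_eq_Ioi (zero_le_one (α := ℝ))]
    exact h01.union h1
  have hneg : IntegrableOn (fun t => Real.exp (logWeight a b t)) (Set.Iio 0) := by
    have h := (Measure.measurePreserving_neg (volume : Measure ℝ)).integrableOn_comp_preimage
      (Homeomorph.neg ℝ).measurableEmbedding (f := fun t => Real.exp (logWeight a b t))
      (s := Set.Ioi 0)
    have h' := h.2 h0
    simpa [Function.comp_def, logWeight_neg] using h'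
  rw [← integrableOn_univ, ← Set.Iic_union_Ioi (a := (0 : ℝ))]
  exact (integrableOn_Iic_iff_integrableOn_Iio (by finiteness) |>.2 hneg).union h0

theorem integrable_mul_comp_sub {α : Type*} [MeasurableSpace α] {μ : Measure α} [SFinite μ]
    {P : α → ℝ} (hP : Integrable P μ) {E : ℝ → ℝ} (hE : Integrable E) (hEm : Measurable E)
    {φ : α → ℝ} (hφ : Measurable φ) :
    Integrable (fun p : ℝ × α => P p.2 * E (p.1 - φ p.2)) ((volume : Measure ℝ).prod μ) := by
  have hm : AEStronglyMeasurable (fun p : ℝ × α => P p.2 * E (p.1 - φ p.2))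
      ((volume : Measure ℝ).prod μ) :=
    hP.1.comp_snd.mul
      (hEm.comp (measurable_fst.sub (hφ.comp measurable_snd))).aestronglyMeasurable
  rw [integrable_prod_iff' hm]
  refine ⟨Filter.Eventually.of_forall fun y => (hE.comp_sub_right (φ y)).const_mul (P y), ?_⟩
  have : (fun y => ∫ x, ‖P y * E (x - φ y)‖) = fun y => ‖P y‖ * ∫ x, ‖E x‖ := by
    funext y
    simp_rw [norm_mul]
    rw [integral_const_mul, integral_sub_right_eq_self (fun x => ‖E x‖)]
  simp only
  rw [this]
  exact hP.norm.mul_const _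

theorem integrable_forestKernel {a b : ℝ} (ha : a < 1) (hb : 1 < b) :
    ∀ n : ℕ, Integrable (forestKernel a b n)
  | 0 => by
    have : forestKernel a b 0 = fun _ => 1 := by funext y; rfl
    rw [this, volume_pi]
    exact integrable_const _
  | n + 1 => by
    have ih := integrable_forestKernel ha hb n
    have hE := integrable_exp_logWeight ha hb
    have hEm := measurable_exp_logWeight a b
    let g : ℝ × (Fin n → ℝ) → ℝ := fun p =>
      forestKernel a b n p.2 * Real.exp (logWeight a b (p.1 - 0)) +
      forestKernel a b n p.2 * Real.exp (logWeight a b (p.1 - 1)) +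
      ∑ i, forestKernel a b n p.2 * Real.exp (logWeight a b (p.1 - p.2 i))
    have hg : Integrable g (volume.prod volume) :=
      ((integrable_mul_comp_sub ih hE hEm (φ := fun _ => 0) measurable_const).add
        (integrable_mul_comp_sub ih hE hEm (φ := fun _ => 1) measurable_const)).add
        (integrable_finsetSum _ fun i _ =>
          integrable_mul_comp_sub ih hE hEm (φ := fun y => y i) (measurable_pi_apply i))
    have he := volume_preserving_piFinSuccAbove (fun _ : Fin (n + 1) => ℝ) (Fin.last n)
    have h := (he.integrable_comp_emb (MeasurableEquiv.measurableEmbedding _) (g := g)).2 hg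
    refine h.congr (Filter.Eventually.of_forall fun y => ?_)
    have hs : logWeight a b (1 - y (Fin.last n)) = logWeight a b (y (Fin.last n) - 1) := by
      rw [← logWeight_neg, neg_sub]
    simp [g, forestKernel, hs, mul_add, Finset.mul_sum]
    rfl

theorem integrable_sum_perm_forestKernel {a b : ℝ} (ha : a < 1) (hb : 1 < b) (n : ℕ) :
    Integrable fun x : Fin n → ℝ =>
      ∑ σ : Equiv.Perm (Fin n), forestKernel a b n (x ∘ σ) := by
  refine integrable_finsetSum _ fun σ _ => ?_
  have he := volume_measurePreserving_piCongrLeft (fun _ : Fin n => ℝ) σ.symm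
  have h := (he.integrable_comp_emb (MeasurableEquiv.measurableEmbedding _)
    (g := forestKernel a b n)).2 (integrable_forestKernel ha hb n)
  refine h.congr (Filter.Eventually.of_forall fun x => ?_)
  simp only [Function.comp_apply]
  congr 1
  funext i
  have := MeasurableEquiv.piCongrLeft_apply_apply (β := fun _ : Fin n => ℝ) σ.symm x (σ i)
  simpa using this

/-- If the functions `ψ * exp (L · s')`, with `L x` linear in the parameter `s'`, are dominated by
an integrable function uniformly for `s'` near `s`, then their integral is complex differentiable
in the parameter at `s`. -/
theorem differentiableAt_integral_mul_exp {α E : Type*} [MeasurableSpace α] {μ : Measure α}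
    [NormedAddCommGroup E] [NormedSpace ℂ E] {ψ : α → ℂ} {L : α → E →L[ℂ] ℂ}
    (hψ : AEStronglyMeasurable ψ μ) (hL : AEStronglyMeasurable L μ) {s : E} {r : ℝ} (hr : 0 < r)
    {bound : α → ℝ} (hb : Integrable bound μ)
    (h : ∀ x, ∀ s' ∈ Metric.ball s r, ‖ψ x * Complex.exp (L x s')‖ ≤ bound x) :
    DifferentiableAt ℂ (fun s' => ∫ x, ψ x * Complex.exp (L x s') ∂μ) s := by
  have hF : ∀ s', AEStronglyMeasurable (fun x => ψ x * Complex.exp (L x s')) μ := fun s' =>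
    hψ.mul (Complex.continuous_exp.comp_aestronglyMeasurable
      ((ContinuousLinearMap.apply ℂ ℂ s').continuous.comp_aestronglyMeasurable hL))
  have hr4 : 0 < r / 4 := by positivity
  refine (hasFDerivAt_integral_of_dominated_of_fderiv_le
    (F' := fun s' x => (ψ x * Complex.exp (L x s')) • L x) (bound := fun x => (r / 4)⁻¹ * bound x)
    (Metric.ball_mem_nhds s (half_pos hr)) (Filter.Eventually.of_forall hF)
    (hb.mono' (hF s) (Filter.Eventually.of_forall fun x => h x s (Metric.mem_ball_self hr)))
    ((hF s).smul hL) (Filter.Eventually.of_forall fun x s' hs' => ?_) (hb.const_mul _)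
    (Filter.Eventually.of_forall fun x s' _ => ?_)).differentiableAt
  · have hbx : 0 ≤ bound x := (norm_nonneg _).trans (h x s (Metric.mem_ball_self hr))
    refine ContinuousLinearMap.opNorm_le_bound _ (by positivity) fun v => ?_
    rw [smul_apply, smul_eq_mul, norm_mul]
    rcases eq_or_ne (L x v) 0 with hv | hv
    · rw [hv, norm_zero, mul_zero]
      positivity
    have hv' : 0 < ‖L x v‖ := norm_pos_iff.2 hv
    have hv0 : 0 < ‖v‖ := norm_pos_iff.2 fun h0 => hv (by rw [h0, map_zero])
    set ρ : ℝ := r / 4 / ‖v‖ with hρ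
    have hρ0 : 0 < ρ := by positivity
    set ζ : ℂ := (ρ / ‖L x v‖ : ℝ) * (starRingEnd ℂ) (L x v) with hζ
    have hζn : ‖ζ‖ = ρ := by
      rw [hζ, norm_mul, Complex.norm_real, RCLike.norm_conj, Real.norm_of_nonneg (by positivity)]
      field_simp
    have hLζ : L x (ζ • v) = ((ρ * ‖L x v‖ : ℝ) : ℂ) := by
      rw [map_smul, smul_eq_mul, hζ, mul_assoc, Complex.conj_mul', ← Complex.ofReal_pow,
        ← Complex.ofReal_mul]
      congr 1
      field_simp
    have hmem : s' + ζ • v ∈ Metric.ball s r := by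
      rw [Metric.mem_ball, dist_eq_norm] at hs' ⊢
      have h2 : ‖ζ • v‖ = r / 4 := by
        rw [norm_smul, hζn, hρ]
        field_simp
      calc ‖s' + ζ • v - s‖ = ‖(s' - s) + ζ • v‖ := by congr 1; abel
        _ ≤ ‖s' - s‖ + ‖ζ • v‖ := norm_add_le _ _
        _ < r := by linarith
    have hkey := h x _ hmem
    rw [map_add, Complex.exp_add, ← mul_assoc, norm_mul, hLζ, Complex.norm_exp,
      Complex.ofReal_re] at hkey
    have hexp := Real.add_one_le_exp (ρ * ‖L x v‖)
    have hle : ‖ψ x * Complex.exp (L x s')‖ * (ρ * ‖L x v‖) ≤ bound x :=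
      (mul_le_mul_of_nonneg_left (by linarith) (norm_nonneg _)).trans hkey
    have hfac : ‖ψ x * Complex.exp (L x s')‖ * ‖L x v‖ =
        (r / 4)⁻¹ * (‖ψ x * Complex.exp (L x s')‖ * (ρ * ‖L x v‖)) * ‖v‖ := by
      rw [hρ]
      field_simp
    rw [hfac]
    gcongr
  · have h1 : HasFDerivAt (fun s' => ψ x * Complex.exp (L x s'))
        (ψ x • (Complex.exp (L x s') • L x)) s' :=
      ((L x).hasFDerivAt.cexp).const_mul (ψ x)
    rwa [smul_smul] at h1

/-- The linear form in the exponents whose exponential is the Koba-Nielsen integrand at `x`. -/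
noncomputable def exponentForm {n : ℕ} (x : Fin n → ℝ) :
    ((Fin n → ℂ) × (Fin n → ℂ) × (Fin n → Fin n → ℂ)) →L[ℂ] ℂ :=
  ∑ j, ((Real.log |x j| : ℝ) : ℂ) •
      (ContinuousLinearMap.proj (R := ℂ) (φ := fun _ : Fin n => ℂ) j ∘L
        ContinuousLinearMap.fst ℂ _ _) +
    ∑ j, ((Real.log |1 - x j| : ℝ) : ℂ) •
      (ContinuousLinearMap.proj (R := ℂ) (φ := fun _ : Fin n => ℂ) j ∘L
        ContinuousLinearMap.fst ℂ _ _ ∘L ContinuousLinearMap.snd ℂ _ _) +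
    ∑ p ∈ univ.filter (fun p : Fin n × Fin n => p.1 < p.2),
      ((Real.log |x p.1 - x p.2| : ℝ) : ℂ) •
        (ContinuousLinearMap.proj (R := ℂ) (φ := fun _ : Fin n => ℂ) p.2 ∘L
          ContinuousLinearMap.proj (R := ℂ) (φ := fun _ : Fin n => Fin n → ℂ) p.1 ∘L
          ContinuousLinearMap.snd ℂ _ _ ∘L ContinuousLinearMap.snd ℂ _ _)

theorem exponentForm_apply {n : ℕ} (x : Fin n → ℝ)
    (s : (Fin n → ℂ) × (Fin n → ℂ) × (Fin n → Fin n → ℂ)) :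
    exponentForm x s = ∑ j, ((Real.log |x j| : ℝ) : ℂ) * s.1 j +
      ∑ j, ((Real.log |1 - x j| : ℝ) : ℂ) * s.2.1 j +
      ∑ p ∈ univ.filter (fun p : Fin n × Fin n => p.1 < p.2),
        ((Real.log |x p.1 - x p.2| : ℝ) : ℂ) * s.2.2 p.1 p.2 := by
  simp [exponentForm]

theorem stronglyMeasurable_exponentForm {n : ℕ} :
    StronglyMeasurable fun x : Fin n → ℝ => exponentForm x := by
  unfold exponentForm
  refine ((Finset.stronglyMeasurable_fun_sum _ fun j _ => ?_).add
    (Finset.stronglyMeasurable_fun_sum _ fun j _ => ?_)).add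
    (Finset.stronglyMeasurable_fun_sum _ fun p _ => ?_)
  all_goals
    refine StronglyMeasurable.smul_const (Measurable.stronglyMeasurable ?_) _
    fun_prop

/-- The configurations whose points are distinct from each other and from `0` and `1`. -/
def distinctConfigurations (n : ℕ) : Set (Fin n → ℝ) :=
  {x | (∀ j, x j ≠ 0) ∧ (∀ j, 1 - x j ≠ 0) ∧ ∀ i j, i < j → x i - x j ≠ 0}

theorem measurableSet_distinctConfigurations (n : ℕ) :
    MeasurableSet (distinctConfigurations n) := by
  have h : ∀ f : (Fin n → ℝ) → ℝ, Measurable f → MeasurableSet {x | f x ≠ 0} := fun f hf =>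
    (measurableSet_eq_fun hf measurable_const).compl
  have e : distinctConfigurations n = (⋂ j, {x | x j ≠ 0}) ∩ ((⋂ j, {x | 1 - x j ≠ 0}) ∩
      ⋂ i, ⋂ j, ⋂ _ : i < j, {x | x i - x j ≠ 0}) := by
    ext x
    simp [distinctConfigurations]
  rw [e]
  refine (MeasurableSet.iInter fun j => h _ (by fun_prop)).inter
    ((MeasurableSet.iInter fun j => h _ (by fun_prop)).inter
      (MeasurableSet.iInter fun i => MeasurableSet.iInter fun j => MeasurableSet.iInter fun _ =>
        h _ (by fun_prop)))

theorem ofReal_abs_cpow_eq_exp {t : ℝ} (ht : t ≠ 0) (z : ℂ) :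
    ((|t| : ℝ) : ℂ) ^ z = Complex.exp (((Real.log |t| : ℝ) : ℂ) * z) := by
  rw [Complex.cpow_def_of_ne_zero (by exact_mod_cast abs_ne_zero.2 ht),
    Complex.ofReal_log (abs_nonneg t)]

theorem KNintegrand_eq_indicator {N : ℕ}
    {s : (Fin (N - 3) → ℂ) × (Fin (N - 3) → ℂ) × (Fin (N - 3) → Fin (N - 3) → ℂ)}
    (h0 : ∀ j, s.1 j ≠ 0) (h1 : ∀ j, s.2.1 j ≠ 0) (h2 : ∀ i j, i < j → s.2.2 i j ≠ 0)
    (x : Fin (N - 3) → ℝ) :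
    KNintegrand N s.1 s.2.1 s.2.2 x =
      (distinctConfigurations (N - 3)).indicator (fun _ => (1 : ℂ)) x *
        Complex.exp (exponentForm x s) := by
  unfold KNintegrand
  by_cases hx : x ∈ distinctConfigurations (N - 3)
  · rw [Set.indicator_of_mem hx, one_mul, exponentForm_apply, Complex.exp_add, Complex.exp_add,
      Complex.exp_sum, Complex.exp_sum, Complex.exp_sum]
    obtain ⟨g0, g1, g2⟩ := hx
    congr 1
    · congr 1
      · exact Finset.prod_congr rfl fun j _ => ofReal_abs_cpow_eq_exp (g0 j) _
      · exact Finset.prod_congr rfl fun j _ => ofReal_abs_cpow_eq_exp (g1 j) _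
    · refine Finset.prod_congr rfl fun p hp => ofReal_abs_cpow_eq_exp (g2 _ _ ?_) _
      simpa using hp
  · rw [Set.indicator_of_notMem hx, zero_mul]
    simp only [distinctConfigurations, Set.mem_ofPred_eq, not_and_or, not_forall, not_not] at hx
    rcases hx with ⟨j, hj⟩ | ⟨j, hj⟩ | ⟨i, j, hij, hj⟩
    · rw [Finset.prod_eq_zero (mem_univ j) (by rw [hj]; simp [h0 j])]
      simp
    · rw [Finset.prod_eq_zero (f := fun j => ((|1 - x j| : ℝ) : ℂ) ^ s.2.1 j) (mem_univ j)
        (by rw [hj]; simp [h1 j])]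
      simp
    · rw [Finset.prod_eq_zero (i := (i, j))
        (f := fun p : Fin (N - 3) × Fin (N - 3) => ((|x p.1 - x p.2| : ℝ) : ℂ) ^ s.2.2 p.1 p.2)
        (by simpa using hij) (by simp only [hj]; simp [h2 i j hij])]
      simp

theorem re_exponentForm_le {n : ℕ} {a b : ℝ}
    {s : (Fin n → ℂ) × (Fin n → ℂ) × (Fin n → Fin n → ℂ)}
    (h0 : ∀ j, -a ≤ (s.1 j).re ∧ (s.1 j).re ≤ -b)
    (h1 : ∀ j, -a ≤ (s.2.1 j).re ∧ (s.2.1 j).re ≤ -b)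
    (h2 : ∀ i j, i < j → -a ≤ (s.2.2 i j).re ∧ (s.2.2 i j).re ≤ -b) (x : Fin n → ℝ) :
    (exponentForm x s).re ≤ ∑ j, (logWeight a b (x j) + logWeight a b (1 - x j)) +
      ∑ p ∈ univ.filter (fun p : Fin n × Fin n => p.1 < p.2),
        logWeight a b (x p.1 - x p.2) := by
  rw [exponentForm_apply, Finset.sum_add_distrib]
  simp only [Complex.add_re, Complex.re_sum, Complex.re_ofReal_mul]
  refine add_le_add (add_le_add ?_ ?_) ?_
  · exact Finset.sum_le_sum fun j _ =>
      (mul_comm _ _).trans_le (mul_log_abs_le_logWeight (h0 j).1 (h0 j).2 _)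
  · exact Finset.sum_le_sum fun j _ =>
      (mul_comm _ _).trans_le (mul_log_abs_le_logWeight (h1 j).1 (h1 j).2 _)
  · refine Finset.sum_le_sum fun p hp => ?_
    have hp' : p.1 < p.2 := by simpa using hp
    exact (mul_comm _ _).trans_le (mul_log_abs_le_logWeight (h2 _ _ hp').1 (h2 _ _ hp').2 _)

theorem exp_sum_logWeight_le {n : ℕ} {a b : ℝ} (ha : 0 ≤ a) (hb : 0 ≤ b) {x : Fin n → ℝ}
    (hx : x ∈ distinctConfigurations n) :
    Real.exp (∑ j, (logWeight a b (x j) + logWeight a b (1 - x j)) +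
      ∑ p ∈ univ.filter (fun p : Fin n × Fin n => p.1 < p.2), logWeight a b (x p.1 - x p.2)) ≤
      Real.exp (n * (a * Real.log 2)) * ∑ σ : Equiv.Perm (Fin n),
        forestKernel (a * (n + 1) / 2) (b * (n + 3) / 2) n (x ∘ σ) := by
  obtain ⟨g0, g1, g2⟩ := hx
  obtain ⟨σ, hσ⟩ := exists_perm_distTo_le x
  have hne : ∀ i j, i ≠ j → x i - x j ≠ 0 := fun i j hij => by
    rcases hij.lt_or_gt with h | h
    · exact g2 i j h
    · rw [← neg_sub]
      exact neg_ne_zero.2 (g2 j i h)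
  have hle := sum_logWeight_le ha hb (x ∘ σ) (fun j => g0 _) (fun j => g1 _)
    (fun i j hij => hne _ _ (σ.injective.ne hij.ne)) hσ
  have e1 : ∑ j, (logWeight a b ((x ∘ σ) j) + logWeight a b (1 - (x ∘ σ) j)) =
      ∑ j, (logWeight a b (x j) + logWeight a b (1 - x j)) :=
    Equiv.sum_comp σ (fun j => logWeight a b (x j) + logWeight a b (1 - x j))
  have e2 := sum_filter_lt_comp_perm (fun i j => logWeight a b (x i - x j))
    (fun i j => by rw [← logWeight_neg, neg_sub]) σ
  rw [e1] at hle
  simp only [Function.comp_apply] at hle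
  rw [e2] at hle
  refine (Real.exp_le_exp.2 hle).trans ?_
  rw [Real.exp_add]
  refine mul_le_mul_of_nonneg_left ?_ (Real.exp_nonneg _)
  refine (exp_sum_logWeight_distTo_le _ _ n (x ∘ σ)).trans ?_
  exact Finset.single_le_sum
    (f := fun σ : Equiv.Perm (Fin n) =>
      forestKernel (a * (n + 1) / 2) (b * (n + 3) / 2) n (x ∘ σ))
    (fun σ _ => forestKernel_nonneg _ _ _ _) (mem_univ σ)

theorem exists_norm_le_of_forall_le_abs_eq_zero {χ : ℝ → ℝ} (hχ : Continuous χ) {R : ℝ}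
    (h : ∀ x, R ≤ |x| → χ x = 0) : ∃ C, ∀ x, ‖χ x‖ ≤ C := by
  obtain ⟨C, hC⟩ := (isCompact_Icc (a := -R) (b := R)).exists_bound_of_continuousOn
    hχ.continuousOn
  refine ⟨max C 0, fun x => ?_⟩
  rcases le_total R |x| with hx | hx
  · rw [h x hx, norm_zero]
    exact le_max_right _ _
  · exact (hC x (abs_le.1 hx)).trans (le_max_left _ _)

theorem exists_norm_phiI_le (N : ℕ) {χ : ℝ → ℝ} {C : ℝ} (hC : ∀ x, ‖χ x‖ ≤ C)
    (I : Finset (Fin (N - 3))) : ∃ K, 0 ≤ K ∧ ∀ x, ‖phiI N χ I x‖ ≤ K := by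
  have hC0 : 0 ≤ C := (norm_nonneg _).trans (hC 0)
  refine ⟨(∏ _i ∈ I, C) * ∏ _i ∈ Iᶜ, (1 + C), by positivity, fun x => ?_⟩
  rw [phiI, norm_mul, norm_prod, norm_prod]
  gcongr with i _ i _
  · exact hC _
  · exact (norm_sub_le _ _).trans (by rw [norm_one]; linarith [hC (x i)])

theorem measurable_phiI (N : ℕ) {χ : ℝ → ℝ} (hχ : Continuous χ) (I : Finset (Fin (N - 3))) :
    Measurable (phiI N χ I) := by
  have : Continuous (phiI N χ I) := by
    unfold phiI
    fun_prop
  exact this.measurable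

theorem eventually_margin {ι : Type*} [Finite ι] {f : ι → ℝ} {lo hi : ℝ}
    (h : ∀ i, lo < f i ∧ f i < hi) :
    ∀ᶠ r in nhdsWithin (0 : ℝ) (Set.Ioi 0), ∀ i, lo + 2 * r ≤ f i ∧ f i ≤ hi - 2 * r := by
  refine Filter.eventually_all.2 fun i => ?_
  have hlim1 : Filter.Tendsto (fun r : ℝ => lo + 2 * r) (nhdsWithin 0 (Set.Ioi 0)) (nhds lo) := by
    have : ContinuousAt (fun r : ℝ => lo + 2 * r) 0 := by fun_prop
    simpa using this.tendsto.mono_left nhdsWithin_le_nhds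
  have hlim2 : Filter.Tendsto (fun r : ℝ => hi - 2 * r) (nhdsWithin 0 (Set.Ioi 0)) (nhds hi) := by
    have : ContinuousAt (fun r : ℝ => hi - 2 * r) 0 := by fun_prop
    simpa using this.tendsto.mono_left nhdsWithin_le_nhds
  filter_upwards [hlim1.eventually_lt_const (h i).1, hlim2.eventually_const_lt (h i).2]
    with r h1 h2 using ⟨h1.le, h2.le⟩

theorem exists_margin_of_mem_KNregion {N : ℕ} {lo hi : ℝ} (hlt : lo < hi)
    {s : (Fin (N - 3) → ℂ) × (Fin (N - 3) → ℂ) × (Fin (N - 3) → Fin (N - 3) → ℂ)}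
    (hs : s ∈ KNregion N lo hi) :
    ∃ r > 0, lo + r ≤ hi ∧ ∀ s' ∈ Metric.ball s r,
      (∀ j, lo + r ≤ (s'.1 j).re ∧ (s'.1 j).re ≤ hi - r) ∧
      (∀ j, lo + r ≤ (s'.2.1 j).re ∧ (s'.2.1 j).re ≤ hi - r) ∧
      (∀ i j, i < j → lo + r ≤ (s'.2.2 i j).re ∧ (s'.2.2 i j).re ≤ hi - r) := by
  obtain ⟨m0, m1, m2⟩ := hs
  have e0 := eventually_margin m0
  have e1 := eventually_margin m1
  have e2 := eventually_margin (ι := {p : Fin (N - 3) × Fin (N - 3) // p.1 < p.2})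
    (f := fun p => (s.2.2 p.1.1 p.1.2).re) (fun p => m2 _ _ p.2)
  have e3 := eventually_margin (ι := Unit) (f := fun _ => (lo + hi) / 2) (lo := lo) (hi := hi)
    (fun _ => ⟨by linarith, by linarith⟩)
  obtain ⟨r, hr0, hr1, hr2, hr3, hr⟩ :=
    (e0.and (e1.and (e2.and (e3.and self_mem_nhdsWithin)))).exists
  have hr' : 0 < r := hr
  refine ⟨r, hr', by linarith [(hr3 ()).1], fun s' hs' => ?_⟩
  have hd : ‖s' - s‖ < r := by rwa [← dist_eq_norm]
  have key : ∀ z w : ℂ, ‖z - w‖ ≤ ‖s' - s‖ → lo + 2 * r ≤ w.re ∧ w.re ≤ hi - 2 * r →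
      lo + r ≤ z.re ∧ z.re ≤ hi - r := by
    intro z w hzw hw
    have h := abs_le.1 ((Complex.abs_re_le_norm (z - w)).trans (hzw.trans hd.le))
    rw [Complex.sub_re] at h
    exact ⟨by linarith [h.1, hw.1], by linarith [h.2, hw.2]⟩
  have n2 : ‖s'.2 - s.2‖ ≤ ‖s' - s‖ := norm_snd_le (s' - s)
  refine ⟨fun j => key _ _ ?_ (hr0 j), fun j => key _ _ ?_ (hr1 j),
    fun i j hij => key _ _ ?_ (hr2 ⟨(i, j), hij⟩)⟩
  · exact (norm_le_pi_norm (s'.1 - s.1) j).trans (norm_fst_le (s' - s))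
  · exact (norm_le_pi_norm (s'.2.1 - s.2.1) j).trans ((norm_fst_le (s'.2 - s.2)).trans n2)
  · exact (norm_le_pi_norm (s'.2.2 i - s.2.2 i) j).trans
      ((norm_le_pi_norm (s'.2.2 - s.2.2) i).trans ((norm_snd_le (s'.2 - s.2)).trans n2))

/-- For `N ≥ 4`, a smooth cut-off `χ` equal to `1` on `[-2,2]` and vanishing for
`|x| ≥ 2 + ε`, and a proper subset `I ⊊ {2,…,N-2}` (possibly empty), the integral
`Z_I^(N)(s)` converges absolutely and is holomorphic in `s` on the open set where
`-2/(N-2) < Re(s_{ij}) < -2/N` for every index pair `ij`. -/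
theorem kobaNielsen_cutoff_convergent_and_holomorphic (N : ℕ) (hN : 4 ≤ N)
    (ε : ℝ) (hε : 0 < ε) (χ : ℝ → ℝ) (hχ : ContDiff ℝ (⊤ : ℕ∞) χ)
    (hχ1 : ∀ x ∈ Set.Icc (-2 : ℝ) 2, χ x = 1)
    (hχ0 : ∀ x : ℝ, 2 + ε ≤ |x| → χ x = 0)
    (I : Finset (Fin (N - 3))) (hI : I ≠ Finset.univ) :
    (∀ s ∈ KNregion N (-2 / ((N : ℝ) - 2)) (-2 / (N : ℝ)),
      Integrable (fun x => (phiI N χ I x : ℂ) * KNintegrand N s.1 s.2.1 s.2.2 x)) ∧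
    DifferentiableOn ℂ
      (fun s : (Fin (N - 3) → ℂ) × (Fin (N - 3) → ℂ) × (Fin (N - 3) → Fin (N - 3) → ℂ) =>
        ∫ x, (phiI N χ I x : ℂ) * KNintegrand N s.1 s.2.1 s.2.2 x)
      (KNregion N (-2 / ((N : ℝ) - 2)) (-2 / (N : ℝ))) := by
  set lo : ℝ := -2 / ((N : ℝ) - 2) with hlo
  set hi : ℝ := -2 / (N : ℝ) with hhi
  have hN4 : (4 : ℝ) ≤ N := by exact_mod_cast hN
  have hlt : lo < hi := by
    rw [hlo, hhi, div_lt_div_iff₀ (by linarith) (by linarith)]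
    linarith
  have hhi0 : hi < 0 := div_neg_of_neg_of_pos (by norm_num) (by linarith)
  have hcast : ((N - 3 : ℕ) : ℝ) = (N : ℝ) - 3 := by
    rw [Nat.cast_sub (by omega)]
    norm_num
  obtain ⟨C, hC⟩ := exists_norm_le_of_forall_le_abs_eq_zero hχ.continuous hχ0
  obtain ⟨K, hK0, hK⟩ := exists_norm_phiI_le N hC I
  set ψ : (Fin (N - 3) → ℝ) → ℂ := fun x =>
    (phiI N χ I x : ℂ) * (distinctConfigurations (N - 3)).indicator (fun _ => (1 : ℂ)) x with hψ
  have hψm : AEStronglyMeasurable ψ volume :=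
    ((Complex.measurable_ofReal.comp (measurable_phiI N hχ.continuous I)).mul
      (measurable_const.indicator
        (measurableSet_distinctConfigurations (N - 3)))).aestronglyMeasurable
  have hLm := (stronglyMeasurable_exponentForm (n := N - 3)).aestronglyMeasurable (μ := volume)
  have hEq : ∀ s ∈ KNregion N lo hi, ∀ x,
      (phiI N χ I x : ℂ) * KNintegrand N s.1 s.2.1 s.2.2 x =
        ψ x * Complex.exp (exponentForm x s) := by
    intro s hs x
    have hre : ∀ z : ℂ, z.re < hi → z ≠ 0 := by
      rintro z hz rfl
      rw [Complex.zero_re] at hz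
      linarith
    rw [KNintegrand_eq_indicator (fun j => hre _ (hs.1 j).2) (fun j => hre _ (hs.2.1 j).2)
      (fun i j hij => hre _ (hs.2.2 i j hij).2), ← mul_assoc]
  have hloc : ∀ s ∈ KNregion N lo hi, ∃ r > 0, Metric.ball s r ⊆ KNregion N lo hi ∧
      ∃ bound : (Fin (N - 3) → ℝ) → ℝ, Integrable bound ∧ ∀ x, ∀ s' ∈ Metric.ball s r,
        ‖ψ x * Complex.exp (exponentForm x s')‖ ≤ bound x := by
    intro s hs
    obtain ⟨r, hr, hrlo, hball⟩ := exists_margin_of_mem_KNregion hlt hs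
    refine ⟨r, hr, fun s' hs' => ?_, ?_⟩
    · obtain ⟨h0, h1, h2⟩ := hball s' hs'
      exact ⟨fun j => ⟨by linarith [(h0 j).1], by linarith [(h0 j).2]⟩,
        fun j => ⟨by linarith [(h1 j).1], by linarith [(h1 j).2]⟩,
        fun i j hij => ⟨by linarith [(h2 i j hij).1], by linarith [(h2 i j hij).2]⟩⟩
    set a : ℝ := -(lo + r) with ha
    set b : ℝ := -(hi - r) with hb
    have ha0 : 0 ≤ a := by linarith
    have hb0 : 0 ≤ b := by linarith
    have ha1 : a * ((N - 3 : ℕ) + 1) / 2 < 1 := by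
      have : lo * ((N : ℝ) - 2) = -2 := div_mul_cancel₀ _ (by linarith)
      rw [hcast, ha]
      nlinarith
    have hb1 : 1 < b * ((N - 3 : ℕ) + 3) / 2 := by
      have : hi * (N : ℝ) = -2 := div_mul_cancel₀ _ (by linarith)
      rw [hcast, hb]
      nlinarith
    refine ⟨_, ((integrable_sum_perm_forestKernel ha1 hb1 (N - 3)).const_mul
      (Real.exp ((N - 3 : ℕ) * (a * Real.log 2)))).const_mul K, fun x s' hs' => ?_⟩
    by_cases hx : x ∈ distinctConfigurations (N - 3)
    · obtain ⟨h0, h1, h2⟩ := hball s' hs'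
      have hψx : ‖ψ x‖ ≤ K := by
        simpa [hψ, Set.indicator_of_mem hx] using hK x
      rw [norm_mul, Complex.norm_exp]
      refine mul_le_mul hψx ?_ (Real.exp_nonneg _) hK0
      refine (Real.exp_le_exp.2 (re_exponentForm_le (a := a) (b := b) ?_ ?_ ?_ x)).trans
        (exp_sum_logWeight_le ha0 hb0 hx)
      all_goals simpa only [ha, hb, neg_neg]
    · have hψx : ψ x = 0 := by simp [hψ, Set.indicator_of_notMem hx]
      rw [hψx, zero_mul, norm_zero]
      exact mul_nonneg hK0 (mul_nonneg (Real.exp_nonneg _)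
        (Finset.sum_nonneg fun σ _ => forestKernel_nonneg _ _ _ _))
  refine ⟨fun s hs => ?_, fun s hs => ?_⟩
  · obtain ⟨r, hr, -, bound, hb, hle⟩ := hloc s hs
    simp_rw [hEq s hs]
    refine hb.mono' (hψm.mul ?_) (Filter.Eventually.of_forall fun x =>
      hle x s (Metric.mem_ball_self hr))
    exact Complex.continuous_exp.comp_aestronglyMeasurable
      ((ContinuousLinearMap.apply ℂ ℂ s).continuous.comp_aestronglyMeasurable hLm)
  · obtain ⟨r, hr, hsub, bound, hb, hle⟩ := hloc s hs
    refine DifferentiableAt.differentiableWithinAt ?_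
    refine (differentiableAt_integral_mul_exp hψm hLm hr hb hle).congr_of_eventuallyEq ?_
    filter_upwards [Metric.ball_mem_nhds s hr] with s' hs'
    exact integral_congr_ae (Filter.Eventually.of_forall fun x => hEq s' (hsub hs') x)
end

section
/- Let N ≥ 4 and l ≥ 1 be integers, and let B, C be real numbers with 0 < B < C < 1/(N−2) and C − B = 1/N. For each i define 𝒰_i ⊂ ℂ^{l+1} as the set of vectors k = (k_0, k_1, …, k_l) such that √C < Re(k_0) < √(1/(N−2)), 0 < Im(k_0) < √B, and for every m = 1,…,l: 0 < Re(k_m) < √(B/l) and √(C/l) < Im(k_m) < √(1/(l(N−2))). Then for any vectors k, k′ ∈ ℂ^{l+1}, each lying in such a set 𝒰_i, the Minkowski product satisfies −2/(N−2) < Re(k·k′) < −2/N. -/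
open Finset

/-- The Minkowski product `k·k' = -k₀k'₀ + ∑_{m=1}^{l} kₘk'ₘ` of two vectors in `ℂ^{l+1}`. -/
noncomputable def minkC (l : ℕ) (k k' : Fin (l + 1) → ℂ) : ℂ :=
  -(k 0 * k' 0) + ∑ m : Fin l, k m.succ * k' m.succ

/-- Membership in the set `𝒰_i ⊂ ℂ^{l+1}`: `√C < Re k₀ < √(1/(N-2))`, `0 < Im k₀ < √B`,
and for `m = 1,…,l`: `0 < Re kₘ < √(B/l)` and `√(C/l) < Im kₘ < √(1/(l(N-2)))`. -/
def inU (N l : ℕ) (B C : ℝ) (k : Fin (l + 1) → ℂ) : Prop :=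
  (Real.sqrt C < (k 0).re ∧ (k 0).re < Real.sqrt (1 / ((N : ℝ) - 2))) ∧
  (0 < (k 0).im ∧ (k 0).im < Real.sqrt B) ∧
  ∀ m : Fin l,
    (0 < (k m.succ).re ∧ (k m.succ).re < Real.sqrt (B / (l : ℝ))) ∧
    (Real.sqrt (C / (l : ℝ)) < (k m.succ).im ∧
      (k m.succ).im < Real.sqrt (1 / ((l : ℝ) * ((N : ℝ) - 2))))

theorem lt_mul_of_sqrt_lt {x a b : ℝ} (hx : 0 ≤ x) (ha : √x < a) (hb : √x < b) :
    x < a * b := by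
  nlinarith [Real.mul_self_sqrt hx, Real.sqrt_nonneg x]

theorem mul_lt_of_lt_sqrt {x a b : ℝ} (ha₀ : 0 < a) (ha : a < √x) (hb : b < √x) :
    a * b < x := by
  have hx : 0 < x := Real.sqrt_pos.mp (ha₀.trans ha)
  nlinarith [Real.mul_self_sqrt hx.le]

/-- If `N ≥ 4`, `l ≥ 1`, `0 < B < C < 1/(N-2)` and `C - B = 1/N`, then for any vectors
`k, k' ∈ ℂ^{l+1}` lying in the set `𝒰_i`, the Minkowski product satisfies
`-2/(N-2) < Re(k·k') < -2/N`. -/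
theorem minkowski_product_in_band (N l : ℕ) (hN : 4 ≤ N) (hl : 1 ≤ l) (B C : ℝ)
    (hB : 0 < B) (hBC : B < C) (hC : C < 1 / ((N : ℝ) - 2)) (hCB : C - B = 1 / (N : ℝ))
    (k k' : Fin (l + 1) → ℂ) (hk : inU N l B C k) (hk' : inU N l B C k') :
    -2 / ((N : ℝ) - 2) < (minkC l k k').re ∧ (minkC l k k').re < -2 / (N : ℝ) := by
  have hl₀ : (0 : ℝ) < l := by exact_mod_cast hl
  have hC₀ : 0 < C := hB.trans hBC
  obtain ⟨⟨a₁, a₂⟩, ⟨b₁, b₂⟩, h⟩ := hk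
  obtain ⟨⟨a₁', a₂'⟩, ⟨b₁', b₂'⟩, h'⟩ := hk'
  have re_minkC : (minkC l k k').re = -((k 0).re * (k' 0).re - (k 0).im * (k' 0).im) +
      ∑ m : Fin l, ((k m.succ).re * (k' m.succ).re - (k m.succ).im * (k' m.succ).im) := by
    simp [minkC, Complex.mul_re]
  have time_lower := lt_mul_of_sqrt_lt hC₀.le a₁ a₁'
  have time_upper := mul_lt_of_lt_sqrt ((Real.sqrt_nonneg _).trans_lt a₁) a₂ a₂'
  have time_im_upper := mul_lt_of_lt_sqrt b₁ b₂ b₂'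
  have time_im_pos := mul_pos b₁ b₁'
  have space_upper : ∑ m : Fin l, ((k m.succ).re * (k' m.succ).re -
      (k m.succ).im * (k' m.succ).im) ≤ B - C := by
    calc _ ≤ ∑ _m : Fin l, (B / l - C / l) := sum_le_sum fun m _ ↦ by
          obtain ⟨⟨c₁, c₂⟩, d₁, d₂⟩ := h m
          obtain ⟨⟨c₁', c₂'⟩, d₁', d₂'⟩ := h' m
          exact sub_le_sub (mul_lt_of_lt_sqrt c₁ c₂ c₂').le
            (lt_mul_of_sqrt_lt (by positivity) d₁ d₁').le
      _ = B - C := by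
          rw [sum_const, card_univ, Fintype.card_fin, nsmul_eq_mul]
          field_simp
  have space_lower : -(1 / ((N : ℝ) - 2)) ≤ ∑ m : Fin l, ((k m.succ).re * (k' m.succ).re -
      (k m.succ).im * (k' m.succ).im) := by
    calc -(1 / ((N : ℝ) - 2)) = ∑ _m : Fin l, (0 - 1 / ((l : ℝ) * ((N : ℝ) - 2))) := by
          rw [sum_const, card_univ, Fintype.card_fin, nsmul_eq_mul, zero_sub, one_div, one_div,
            mul_inv, mul_neg, mul_inv_cancel_left₀ hl₀.ne']
      _ ≤ _ := sum_le_sum fun m _ ↦ by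
          obtain ⟨⟨c₁, c₂⟩, d₁, d₂⟩ := h m
          obtain ⟨⟨c₁', c₂'⟩, d₁', d₂'⟩ := h' m
          exact sub_le_sub (mul_pos c₁ c₁').le
            (mul_lt_of_lt_sqrt ((Real.sqrt_nonneg _).trans_lt d₁) d₂ d₂').le
  have neg_two_div (x : ℝ) : -2 / x = -(2 * (1 / x)) := by ring
  rw [re_minkC, neg_two_div, neg_two_div]
  constructor <;> linarith
end

section
/- Let N ≥ 4 and l ≥ 1 be integers, and let B, C be real numbers with 0 < B < C < 1/(N−2) and C − B = 1/N, defining the open set 𝒰 = 𝒰_1 × ⋯ × 𝒰_{N−1} ⊂ ℂ^{(N−1)(l+1)}. Then for every (k_1, …, k_{N−1}) ∈ 𝒰, the real Koba-Nielsen amplitude integral A^(N)(k) = ∫_{ℝ^{N-3}} ∏_{j=2}^{N-2} |x_j|^{k_1·k_j} |1−x_j|^{k_{N−1}·k_j} ∏_{2≤i<j≤N-2} |x_i−x_j|^{k_i·k_j} ∏ dx_i converges absolutely, and k ↦ A^(N)(k) is holomorphic on 𝒰. -/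
open MeasureTheory Finset

/-- The integrand of the Koba-Nielsen amplitude `A^(N)(k)`: here `k i` represents the
momentum vector `k_{i+1} ∈ ℂ^{l+1}` (so `k 0 = k₁` and `k (N-2) = k_{N-1}`), and
`x j` represents the integration variable `x_{j+2}`; the exponents are the Minkowski
products `k_i·k_j`. -/
noncomputable def ampIntegrand (N l : ℕ) (hN : 4 ≤ N)
    (k : Fin (N - 1) → Fin (l + 1) → ℂ) (x : Fin (N - 3) → ℝ) : ℂ :=
  (∏ j : Fin (N - 3),
      ((|x j| : ℝ) : ℂ) ^
          minkC l (k ⟨0, by omega⟩) (k ⟨j.1 + 1, by have := j.isLt; omega⟩) *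
        ((|1 - x j| : ℝ) : ℂ) ^
          minkC l (k ⟨N - 2, by omega⟩) (k ⟨j.1 + 1, by have := j.isLt; omega⟩)) *
    ∏ q ∈ Finset.univ.filter (fun q : Fin (N - 3) × Fin (N - 3) => q.1 < q.2),
      ((|x q.1 - x q.2| : ℝ) : ℂ) ^
        minkC l (k ⟨q.1.1 + 1, by have := q.1.isLt; omega⟩)
          (k ⟨q.2.1 + 1, by have := q.2.isLt; omega⟩)

section Gaps

open Real

lemma posLog_mono {s t : ℝ} (hs : 0 ≤ s) (hst : s ≤ t) : log⁺ s ≤ log⁺ t :=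
  monotoneOn_posLog hs (hs.trans hst) hst

lemma posLog_inv_anti {s t : ℝ} (hs : 0 < s) (hst : s ≤ t) : log⁺ t⁻¹ ≤ log⁺ s⁻¹ :=
  posLog_mono (inv_nonneg.2 (hs.le.trans hst)) (inv_anti₀ hs hst)

/-- In the sum over all pairs `i < j` among `M + 1` points, assigning to a pair its first and its
last gap counts every gap `M + 1` times. -/
lemma sum_pairs_first_add_last (u : ℕ → ℝ) (M : ℕ) :
    ∑ j ∈ range (M + 1), ∑ i ∈ range j, (u i + u (j - 1)) = (M + 1) * ∑ k ∈ range M, u k := by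
  induction M with
  | zero => simp
  | succ M ih =>
    rw [sum_range_succ, ih, sum_range_succ u]
    simp only [sum_add_distrib, sum_const, card_range, Nat.add_sub_cancel, nsmul_eq_mul]
    rw [sum_range_succ u]
    push_cast
    ring

/-- The gaps which end up adjacent to a removed gap `m`: among the pairs that start at `m` or end
at `m + 1`, the remaining extreme gaps are counted exactly once. -/
lemma sum_pairs_adjacent (u : ℕ → ℝ) (m : ℕ) (hm : u m = 0) (M : ℕ) :
    ∑ j ∈ range (M + 1), ∑ i ∈ range j,
      ((if j = m + 1 then u i else 0) + (if i = m then u (j - 1) else 0)) =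
      if m < M then ∑ k ∈ range M, u k else 0 := by
  induction M with
  | zero => simp
  | succ M ih =>
    rw [sum_range_succ, ih]
    simp only [sum_add_distrib, Nat.add_sub_cancel, Nat.add_right_cancel_iff, sum_ite_eq', mem_range]
    rcases lt_trichotomy m M with h | h | h
    · rw [if_pos h, if_pos (by omega), if_pos (by omega)]
      simp [h.ne', sum_range_succ]
    · subst h
      simp [sum_range_succ, hm]
    · rw [if_neg (by omega), if_neg (by omega), if_neg (by omega)]
      simp [h.ne]

lemma sum_pairs_posLog_inv_le {n m : ℕ} (hm : m ≤ n) (Z : ℕ → ℝ) (hmono : Monotone Z)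
    (hpos : ∀ k ≤ n, Z k < Z (k + 1)) (hgap : ((n : ℝ) + 1)⁻¹ ≤ Z (m + 1) - Z m) :
    2 * ∑ j ∈ range (n + 2), ∑ i ∈ range j, log⁺ (Z j - Z i)⁻¹ ≤
      (∑ j ∈ range (n + 2), ∑ _i ∈ range j, 2 * log⁺ ((n : ℝ) + 1)) +
      (n + 1) * ∑ k ∈ range (n + 1), if k = m then 0 else log⁺ (Z (k + 1) - Z k)⁻¹ := by
  set u : ℕ → ℝ := fun k => if k = m then 0 else log⁺ (Z (k + 1) - Z k)⁻¹ with hu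
  have hu0 : ∀ k, 0 ≤ u k := fun k => by
    simp only [hu]; split_ifs <;> simp [posLog_nonneg]
  have hum : u m = 0 := by simp [hu]
  have h1 := sum_pairs_first_add_last u (n + 1)
  have h2 := sum_pairs_adjacent u m hum (n + 1)
  rw [if_pos (by omega)] at h2
  have key : ∀ j ∈ range (n + 2), ∀ i ∈ range j,
      2 * log⁺ (Z j - Z i)⁻¹ ≤ 2 * log⁺ ((n : ℝ) + 1) + ((u i + u (j - 1)) -
        ((if j = m + 1 then u i else 0) + (if i = m then u (j - 1) else 0))) := by
    intro j hj i hi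
    rw [mem_range] at hj hi
    have hc : 0 ≤ log⁺ ((n : ℝ) + 1) := posLog_nonneg
    by_cases hstr : i ≤ m ∧ m + 1 ≤ j
    · have : log⁺ (Z j - Z i)⁻¹ ≤ log⁺ ((n : ℝ) + 1) := by
        have := posLog_inv_anti (s := ((n : ℝ) + 1)⁻¹) (t := Z j - Z i) (by positivity)
          (hgap.trans (sub_le_sub (hmono hstr.2) (hmono hstr.1)))
        simpa using this
      have hi0 := hu0 i
      have hj0 := hu0 (j - 1)
      split_ifs with ha hb hb
      · subst ha hb; simp [hum]; exact this
      · linarith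
      · linarith
      · linarith
    · have hjm : j ≠ m + 1 := by omega
      have him : i ≠ m := by omega
      have hjm' : j - 1 ≠ m := by omega
      obtain ⟨j, rfl⟩ : ∃ j', j = j' + 1 := ⟨j - 1, by omega⟩
      have e1 : log⁺ (Z (j + 1) - Z i)⁻¹ ≤ u i := by
        simp only [hu, if_neg him]
        exact posLog_inv_anti (sub_pos.2 (hpos i (by omega)))
          (sub_le_sub_right (hmono (by omega)) _)
      have e2 : log⁺ (Z (j + 1) - Z i)⁻¹ ≤ u j := by
        simp only [Nat.add_sub_cancel] at hjm'
        simp only [hu, if_neg hjm']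
        exact posLog_inv_anti (sub_pos.2 (hpos j (by omega)))
          (sub_le_sub_left (hmono (by omega)) _)
      rw [if_neg hjm, if_neg him, Nat.add_sub_cancel]
      linarith
  calc _ = ∑ j ∈ range (n + 2), ∑ i ∈ range j, 2 * log⁺ (Z j - Z i)⁻¹ := by
        simp only [mul_sum]
    _ ≤ _ := sum_le_sum fun j hj => sum_le_sum (key j hj)
    _ = _ := by
        simp only [sum_add_distrib, sum_sub_distrib] at h1 h2 ⊢
        push_cast at h1
        linear_combination h1 - h2

lemma le_sum_pairs_posLog {n m : ℕ} (hm : m ≤ n) (Z : ℕ → ℝ) (hmono : Monotone Z)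
    (hgap : Z (m + 1) - Z m ≤ 1) :
    (n + 3) * ∑ k ∈ range (n + 1), (if k = m then 0 else log⁺ (Z (k + 1) - Z k)) ≤
      2 * ∑ j ∈ range (n + 2), ∑ i ∈ range j, log⁺ (Z j - Z i) := by
  set u : ℕ → ℝ := fun k => if k = m then 0 else log⁺ (Z (k + 1) - Z k) with hu
  have hu' : ∀ k, u k = log⁺ (Z (k + 1) - Z k) := fun k => by
    simp only [hu]
    split_ifs with h
    · subst h
      rw [eq_comm, posLog_eq_zero_iff, abs_of_nonneg (sub_nonneg.2 (hmono (Nat.le_succ _)))]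
      exact hgap
    · rfl
  have hum : u m = 0 := by simp [hu]
  have h1 := sum_pairs_first_add_last u (n + 1)
  have h2 := sum_pairs_adjacent u m hum (n + 1)
  rw [if_pos (by omega)] at h2
  have key : ∀ j ∈ range (n + 2), ∀ i ∈ range j,
      ((u i + u (j - 1)) +
        ((if j = m + 1 then u i else 0) + (if i = m then u (j - 1) else 0))) ≤
        2 * log⁺ (Z j - Z i) := by
    intro j hj i hi
    rw [mem_range] at hj hi
    obtain ⟨j, rfl⟩ : ∃ j', j = j' + 1 := ⟨j - 1, by omega⟩
    have e1 : u i ≤ log⁺ (Z (j + 1) - Z i) := by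
      rw [hu']
      exact posLog_mono (sub_nonneg.2 (hmono (by omega)))
        (sub_le_sub_right (hmono (by omega)) _)
    have e2 : u j ≤ log⁺ (Z (j + 1) - Z i) := by
      rw [hu']
      exact posLog_mono (sub_nonneg.2 (hmono (by omega)))
        (sub_le_sub_left (hmono (by omega)) _)
    rw [Nat.add_sub_cancel]
    split_ifs with ha hb hb
    · obtain rfl : j = m := by omega
      subst hb; linarith
    · obtain rfl : j = m := by omega
      linarith
    · subst hb; linarith
    · linarith
  calc _ = ∑ j ∈ range (n + 2), ∑ i ∈ range j, ((u i + u (j - 1)) +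
        ((if j = m + 1 then u i else 0) + (if i = m then u (j - 1) else 0))) := by
        simp only [sum_add_distrib] at h1 h2 ⊢
        push_cast at h1
        linear_combination -h1 - h2
    _ ≤ ∑ j ∈ range (n + 2), ∑ i ∈ range j, 2 * log⁺ (Z j - Z i) :=
        sum_le_sum fun j hj => sum_le_sum (key j hj)
    _ = _ := by simp only [mul_sum]

lemma sum_sum_range_eq_two_mul {f : ℕ → ℕ → ℝ} (hsymm : ∀ i j, f i j = f j i)
    (hdiag : ∀ i, f i i = 0) (M : ℕ) :
    ∑ j ∈ range M, ∑ i ∈ range M, f i j = 2 * ∑ j ∈ range M, ∑ i ∈ range j, f i j := by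
  induction M with
  | zero => simp
  | succ M ih =>
    simp only [sum_range_succ, sum_add_distrib, ih, hdiag]
    rw [sum_congr rfl fun j _ => hsymm M j]
    ring

end Gaps

section Forest

open Real

/-- A weight on the line comparable to `|t| ^ (-a)` near `0` and to `|t| ^ (-b)` near infinity. -/
noncomputable def gapWeight (a b t : ℝ) : ℝ := Real.exp (a * log⁺ t⁻¹ - b * log⁺ t)

lemma gapWeight_pos (a b t : ℝ) : 0 < gapWeight a b t := Real.exp_pos _

lemma gapWeight_neg (a b t : ℝ) : gapWeight a b (-t) = gapWeight a b t := by
  simp [gapWeight, inv_neg]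

lemma integrable_gapWeight {a b : ℝ} (ha : a < 1) (hb : 1 < b) : Integrable (gapWeight a b) := by
  have h1 : IntegrableOn (gapWeight a b) (Set.Ioc 0 1) := by
    have h := (intervalIntegral.intervalIntegrable_rpow' (a := 0) (b := 1)
      (r := -a) (by linarith)).1
    refine h.congr_fun (fun t ht => ?_) measurableSet_Ioc
    have hle : |t| ≤ 1 := by rw [abs_of_pos ht.1]; exact ht.2
    have e1 : log⁺ t = 0 := (posLog_eq_zero_iff t).2 hle
    have e2 : log⁺ t⁻¹ = -Real.log t := by
      have := posLog_sub_posLog_inv (x := t)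
      linarith
    simp only [gapWeight, e1, e2, rpow_def_of_pos ht.1]
    ring_nf
  have h2 : IntegrableOn (gapWeight a b) (Set.Ioi 1) := by
    have h := integrableOn_Ioi_rpow_of_lt (a := -b) (by linarith) one_pos
    refine h.congr_fun (fun t ht => ?_) measurableSet_Ioi
    have ht : 1 < t := ht
    have ht0 : 0 < t := by linarith
    have e1 : log⁺ t = Real.log t := posLog_eq_log (by rw [abs_of_pos ht0]; exact ht.le)
    have e2 : log⁺ t⁻¹ = 0 := by
      have := posLog_sub_posLog_inv (x := t)
      linarith
    simp only [gapWeight, e1, e2, rpow_def_of_pos ht0]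
    ring_nf
  have h3 : IntegrableOn (gapWeight a b) (Set.Ioi 0) := by
    have := h1.union h2
    rwa [Set.Ioc_union_Ioi_eq_Ioi zero_le_one] at this
  have h4 := h3.integrable_indicator measurableSet_Ioi
  refine (h4.add h4.comp_neg).congr ?_
  filter_upwards [Measure.ae_ne volume (0 : ℝ)] with t ht
  rcases lt_or_gt_of_ne ht with h | h
  · simp [Set.indicator, h, h.not_gt, gapWeight_neg]
  · simp [Set.indicator, h, h.not_gt]

/-- The marked points `0, 1, x_0, …, x_{n-1}` on the line. -/
noncomputable def markedPoints {n : ℕ} (x : Fin n → ℝ) : Fin (n + 2) → ℝ :=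
  Fin.cons 0 (Fin.cons 1 x)

/-- The linear map sending `x` to the successive differences of the points `0, 0, x_0, …, x_{n-1}`
listed in the order `σ`, the `m`-th difference being omitted. -/
noncomputable def gapMap {n : ℕ} (σ : Equiv.Perm (Fin (n + 2))) (m : Fin (n + 1)) :
    (Fin n → ℝ) →ₗ[ℝ] (Fin n → ℝ) where
  toFun x j := (Fin.cons 0 (Fin.cons 0 x) : Fin (n + 2) → ℝ) (σ (m.succAbove j).succ) -
    (Fin.cons 0 (Fin.cons 0 x) : Fin (n + 2) → ℝ) (σ (m.succAbove j).castSucc)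
  map_add' x y := by
    have h : ∀ a, (Fin.cons 0 (Fin.cons 0 (x + y)) : Fin (n + 2) → ℝ) a =
        (Fin.cons 0 (Fin.cons 0 x) : Fin (n + 2) → ℝ) a +
        (Fin.cons 0 (Fin.cons 0 y) : Fin (n + 2) → ℝ) a := fun a => by
      refine Fin.cases ?_ (fun a => Fin.cases ?_ (fun a => ?_) a) a <;> simp
    ext j
    simp only [h, Pi.add_apply]
    ring
  map_smul' c x := by
    have h : ∀ a, (Fin.cons 0 (Fin.cons 0 (c • x)) : Fin (n + 2) → ℝ) a =
        c * (Fin.cons 0 (Fin.cons 0 x) : Fin (n + 2) → ℝ) a := fun a => by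
      refine Fin.cases ?_ (fun a => Fin.cases ?_ (fun a => ?_) a) a <;> simp
    ext j
    simp only [h, Pi.smul_apply, smul_eq_mul, RingHom.id_apply]
    ring

lemma markedPoints_sub {n : ℕ} (σ : Equiv.Perm (Fin (n + 2))) (m : Fin (n + 1)) (x : Fin n → ℝ)
    (j : Fin n) :
    markedPoints x (σ (m.succAbove j).succ) - markedPoints x (σ (m.succAbove j).castSucc) =
      (markedPoints 0 (σ (m.succAbove j).succ) - markedPoints 0 (σ (m.succAbove j).castSucc)) +
      gapMap σ m x j := by
  have h : ∀ a, markedPoints x a = markedPoints 0 a +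
      (Fin.cons 0 (Fin.cons 0 x) : Fin (n + 2) → ℝ) a := fun a => by
    refine Fin.cases ?_ (fun a => Fin.cases ?_ (fun a => ?_) a) a <;> simp [markedPoints]
  rw [h (σ (m.succAbove j).succ), h (σ (m.succAbove j).castSucc)]
  simp only [gapMap, LinearMap.coe_mk, AddHom.coe_mk]
  ring

/-- The removed difference lies between the positions of `0` and `1` in the order `σ`. -/
def Separates {n : ℕ} (σ : Equiv.Perm (Fin (n + 2))) (m : Fin (n + 1)) : Prop :=
  σ.symm 0 ≤ m.castSucc ∧ m.castSucc < σ.symm 1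

lemma gapMap_injective {n : ℕ} {σ : Equiv.Perm (Fin (n + 2))} {m : Fin (n + 1)}
    (h : Separates σ m) : Function.Injective (gapMap σ m) := by
  refine (injective_iff_map_eq_zero _).2 fun x hx => ?_
  set w : Fin (n + 2) → ℝ := fun a => (Fin.cons 0 (Fin.cons 0 x) : Fin (n + 2) → ℝ) (σ a) with hw
  have hstep : ∀ k, k ≠ m → w k.succ = w k.castSucc := fun k hk => by
    obtain ⟨j, rfl⟩ := Fin.exists_succAbove_eq hk
    exact sub_eq_zero.1 (congrFun hx j)
  have hleft : ∀ a, a ≤ m.castSucc → w a = w 0 := by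
    intro a
    induction a using Fin.induction with
    | zero => simp
    | succ k ih =>
      intro hk
      have hkm : k < m := by rwa [← Fin.succ_le_castSucc_iff]
      rw [hstep k hkm.ne, ih (by simpa using hkm.le)]
  have hright : ∀ a, m.castSucc < a → w a = w m.succ := by
    intro a
    induction a using Fin.induction with
    | zero => simp
    | succ k ih =>
      intro hk
      have hkm : m ≤ k := by rwa [← Fin.castSucc_lt_succ_iff]
      rcases hkm.eq_or_lt with rfl | hlt
      · rfl
      · rw [hstep k hlt.ne', ih (by simpa using hlt)]
  have h0 : w (σ.symm 0) = 0 := by simp [hw]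
  have h1 : w (σ.symm 1) = 0 := by
    simp only [hw, Equiv.apply_symm_apply]
    rfl
  have hall : ∀ a, w a = 0 := fun a => by
    rcases le_or_gt a m.castSucc with ha | ha
    · rw [hleft a ha, ← hleft _ h.1, h0]
    · rw [hright a ha, ← hright _ h.2, h1]
  ext j
  have := hall (σ.symm j.succ.succ)
  simpa [hw] using this

lemma integrable_prod_gapWeight {n : ℕ} {σ : Equiv.Perm (Fin (n + 2))} {m : Fin (n + 1)}
    (h : Separates σ m) {a b : ℝ} (ha : a < 1) (hb : 1 < b) :
    Integrable fun x : Fin n → ℝ => ∏ j, gapWeight a b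
      (markedPoints x (σ (m.succAbove j).succ) - markedPoints x (σ (m.succAbove j).castSucc)) := by
  have h1 : Integrable (fun t : Fin n → ℝ => ∏ j, gapWeight a b (t j)) :=
    Integrable.fintype_prod fun _ => integrable_gapWeight ha hb
  have h2 := h1.comp_add_left fun j =>
    markedPoints 0 (σ (m.succAbove j).succ) - markedPoints 0 (σ (m.succAbove j).castSucc)
  have hdet : LinearMap.det (gapMap σ m) ≠ 0 := by
    have hu := (LinearEquiv.ofInjectiveEndo _ (gapMap_injective h)).isUnit_det'
    exact hu.ne_zero
  have hmap := Measure.map_linearMap_addHaar_eq_smul_addHaar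
    (volume : Measure (Fin n → ℝ)) hdet
  have h3 := h2.smul_measure (c := ENNReal.ofReal |(LinearMap.det (gapMap σ m))⁻¹|)
    ENNReal.ofReal_ne_top
  rw [← hmap] at h3
  have h4 := h3.comp_measurable
    (gapMap σ m).continuous_of_finiteDimensional.measurable
  refine h4.congr (Filter.Eventually.of_forall fun x => ?_)
  simp only [Function.comp_apply, markedPoints_sub σ m x, Pi.add_apply]

lemma exists_gap_between {n p q : ℕ} (hq : q ≤ n + 1) (hpq : p < q) (Z : ℕ → ℝ)
    (h : Z q - Z p = 1) : ∃ m, p ≤ m ∧ m < q ∧ ((n : ℝ) + 1)⁻¹ ≤ Z (m + 1) - Z m := by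
  have hsum : ∑ k ∈ Ico p q, (Z (k + 1) - Z k) = 1 := by rw [sum_Ico_sub Z hpq.le, h]
  obtain ⟨m, hm, hle⟩ := exists_le_of_sum_le (s := Ico p q) (f := fun _ => ((n : ℝ) + 1)⁻¹)
    (nonempty_Ico.2 hpq) (g := fun k => Z (k + 1) - Z k) (by
      rw [hsum, sum_const, Nat.card_Ico, nsmul_eq_mul, ← div_eq_mul_inv,
        div_le_one (by positivity)]
      exact_mod_cast (by omega : q - p ≤ n + 1))
  exact ⟨m, (mem_Ico.1 hm).1, (mem_Ico.1 hm).2, hle⟩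

/-- The additive constant in the bound of the integrand by products over gaps. -/
noncomputable def gapConst (n : ℕ) : ℝ :=
  ∑ j ∈ range (n + 2), ∑ _i ∈ range j, 2 * log⁺ ((n : ℝ) + 1)

lemma mul_log_le {r α β : ℝ} (hr : -α ≤ r) (hr' : r ≤ -β) (t : ℝ) :
    r * Real.log |t| ≤ α * log⁺ t⁻¹ - β * log⁺ t := by
  rw [Real.log_abs, ← posLog_sub_posLog_inv]
  have h1 := mul_nonneg (by linarith : 0 ≤ -β - r) (posLog_nonneg (x := t))
  have h2 := mul_nonneg (by linarith : 0 ≤ α + r) (posLog_nonneg (x := t⁻¹))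
  linarith

lemma exists_sum_mul_log_le {n : ℕ} {α β : ℝ} (hα : 0 ≤ α) (hβ : 0 ≤ β) (x : Fin n → ℝ)
    (hx : Function.Injective (markedPoints x)) (r : Fin (n + 2) × Fin (n + 2) → ℝ)
    (hr : ∀ e, -α ≤ r e ∧ r e ≤ -β) :
    ∃ σ m, Separates σ m ∧
      ∑ e, r e * Real.log |markedPoints x e.1 - markedPoints x e.2| ≤
        α * gapConst n + ∑ j : Fin n,
          (α * (n + 1) * log⁺ (markedPoints x (σ (m.succAbove j).succ) -
              markedPoints x (σ (m.succAbove j).castSucc))⁻¹ -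
            β * (n + 3) * log⁺ (markedPoints x (σ (m.succAbove j).succ) -
              markedPoints x (σ (m.succAbove j).castSucc))) := by
  set y := markedPoints x with hy
  set σ := Tuple.sort y with hσ
  have hmono : StrictMono (y ∘ σ) :=
    (Tuple.monotone_sort y).strictMono_of_injective (hx.comp σ.injective)
  set Z : ℕ → ℝ := fun k => y (σ ⟨min k (n + 1), by omega⟩) with hZ
  have hZmono : Monotone Z := fun i j hij => hmono.monotone (by
    rw [Fin.mk_le_mk]; omega)
  have hZpos : ∀ k ≤ n, Z k < Z (k + 1) := fun k hk => hmono (by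
    rw [Fin.mk_lt_mk]; omega)
  have hZa : ∀ a : Fin (n + 2), y (σ a) = Z a := fun a => by
    have : (⟨min (a : ℕ) (n + 1), by omega⟩ : Fin (n + 2)) = a := by
      ext; have := a.isLt; simp only; omega
    simp only [hZ, this]
  have hp : Z (σ.symm 0) = 0 := by rw [← hZa, Equiv.apply_symm_apply]; rfl
  have hq : Z (σ.symm 1) = 1 := by rw [← hZa, Equiv.apply_symm_apply]; rfl
  have hpq : (σ.symm 0 : ℕ) < σ.symm 1 := by
    by_contra hcon
    have := hZmono (not_lt.1 hcon)
    rw [hp, hq] at this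
    norm_num at this
  obtain ⟨m, hpm, hmq, hgap⟩ := exists_gap_between (n := n) (by omega) hpq Z (by rw [hp, hq]; simp)
  have hmn : m ≤ n := by omega
  have hgap' : Z (m + 1) - Z m ≤ 1 := by
    have h1 := hZmono (show m + 1 ≤ (σ.symm 1 : ℕ) from hmq)
    have h2 := hZmono hpm
    rw [hp] at h2; rw [hq] at h1
    linarith
  refine ⟨σ, ⟨m, by omega⟩, ⟨Fin.le_def.2 hpm, Fin.lt_def.2 hmq⟩, ?_⟩
  have hsum : ∀ f : ℝ → ℝ, (∀ t, f (-t) = f t) → f 0 = 0 → ∑ e : Fin (n + 2) × Fin (n + 2),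
      f (y e.1 - y e.2) = 2 * ∑ j ∈ range (n + 2), ∑ i ∈ range j, f (Z j - Z i) := by
    intro f hf hf0
    rw [Fintype.sum_prod_type, ← Equiv.sum_comp σ]
    rw [← sum_sum_range_eq_two_mul (f := fun i j => f (Z j - Z i))
      (fun i j => by rw [← hf, neg_sub]) (fun i => by simp [hf0]),
      ← Fin.sum_univ_eq_sum_range (fun j => ∑ i ∈ range (n + 2), f (Z j - Z i))]
    refine sum_congr rfl fun a _ => ?_
    rw [← Equiv.sum_comp σ, ← Fin.sum_univ_eq_sum_range (fun i => f (Z a - Z i))]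
    simp only [hZa]
  have hgaps : ∀ f : ℝ → ℝ, ∑ k ∈ range (n + 1), (if k = m then 0 else f (Z (k + 1) - Z k)) =
      ∑ j : Fin n, f (y (σ ((⟨m, by omega⟩ : Fin (n + 1)).succAbove j).succ) -
        y (σ ((⟨m, by omega⟩ : Fin (n + 1)).succAbove j).castSucc)) := by
    intro f
    rw [← Fin.sum_univ_eq_sum_range (fun k => if k = m then 0 else f (Z (k + 1) - Z k)),
      Fin.sum_univ_succAbove _ ⟨m, by omega⟩]
    simp only [if_true, zero_add, hZa, Fin.val_succ, Fin.val_castSucc]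
    refine sum_congr rfl fun j _ => if_neg fun hj => ?_
    exact Fin.succAbove_ne ⟨m, by omega⟩ j (Fin.ext hj)
  have h1 := sum_pairs_posLog_inv_le hmn Z hZmono hZpos hgap
  have h2 := le_sum_pairs_posLog hmn Z hZmono hgap'
  rw [hgaps fun t => log⁺ t⁻¹, ← hsum (fun t => log⁺ t⁻¹) (by simp [inv_neg]) (by simp)] at h1
  rw [hgaps fun t => log⁺ t, ← hsum (fun t => log⁺ t) (by simp) (by simp)] at h2
  calc _ ≤ ∑ e : Fin (n + 2) × Fin (n + 2),
        (α * log⁺ (y e.1 - y e.2)⁻¹ - β * log⁺ (y e.1 - y e.2)) :=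
        sum_le_sum fun e _ => mul_log_le (hr e).1 (hr e).2 _
    _ = α * ∑ e : Fin (n + 2) × Fin (n + 2), log⁺ (y e.1 - y e.2)⁻¹ -
        β * ∑ e : Fin (n + 2) × Fin (n + 2), log⁺ (y e.1 - y e.2) := by
        rw [sum_sub_distrib, mul_sum, mul_sum]
    _ ≤ _ := by
        rw [sum_sub_distrib, ← mul_sum, ← mul_sum, gapConst]
        linarith [mul_le_mul_of_nonneg_left h1 hα, mul_le_mul_of_nonneg_left h2 hβ]

end Forest

section Amplitude

/-- The logarithm of the distance between two of the marked points. -/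
noncomputable def logDist {n : ℕ} (x : Fin n → ℝ) (e : Fin (n + 2) × Fin (n + 2)) : ℝ :=
  Real.log |markedPoints x e.1 - markedPoints x e.2|

open Classical in
/-- The Koba-Nielsen integrand with free exponents `s e`, extended by zero to the configurations
in which two marked points coincide. -/
noncomputable def freeIntegrand {n : ℕ} (s : Fin (n + 2) × Fin (n + 2) → ℂ) (x : Fin n → ℝ) : ℂ :=
  if Function.Injective (markedPoints x) then Complex.exp (∑ e, s e * logDist x e) else 0

open Classical in
/-- An integrable majorant of the integrands whose exponents have real part in `[-α, -β]`. -/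
noncomputable def majorant (n : ℕ) (α β : ℝ) (x : Fin n → ℝ) : ℝ :=
  Real.exp (α * gapConst n) * ∑ c : Equiv.Perm (Fin (n + 2)) × Fin (n + 1),
    if Separates c.1 c.2 then ∏ j, gapWeight (α * (n + 1)) (β * (n + 3))
      (markedPoints x (c.1 (c.2.succAbove j).succ) -
        markedPoints x (c.1 (c.2.succAbove j).castSucc)) else 0

lemma integrable_majorant (n : ℕ) {α β : ℝ} (hα : α < 1 / (n + 1)) (hβ : 1 / (n + 3) < β) :
    Integrable (majorant n α β) := by
  refine (integrable_finsetSum _ fun c _ => ?_).const_mul _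
  split_ifs with h
  · exact integrable_prod_gapWeight h ((lt_div_iff₀ (by positivity)).1 hα)
      ((div_lt_iff₀ (by positivity)).1 hβ)
  · exact integrable_zero _ _ _

lemma majorant_nonneg (n : ℕ) (α β : ℝ) (x : Fin n → ℝ) : 0 ≤ majorant n α β x := by
  refine mul_nonneg (Real.exp_pos _).le (sum_nonneg fun c _ => ?_)
  split_ifs
  · exact prod_nonneg fun j _ => (gapWeight_pos _ _ _).le
  · exact le_rfl

lemma exp_sum_logDist_le_majorant {n : ℕ} {α β : ℝ} (hα : 0 ≤ α) (hβ : 0 ≤ β) (x : Fin n → ℝ)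
    (hx : Function.Injective (markedPoints x)) (r : Fin (n + 2) × Fin (n + 2) → ℝ)
    (hr : ∀ e, -α ≤ r e ∧ r e ≤ -β) :
    Real.exp (∑ e, r e * logDist x e) ≤ majorant n α β x := by
  obtain ⟨σ, m, hσ, hle⟩ := exists_sum_mul_log_le hα hβ x hx r hr
  refine (Real.exp_le_exp.2 hle).trans ?_
  rw [Real.exp_add, Real.exp_sum, majorant]
  refine mul_le_mul_of_nonneg_left ?_ (Real.exp_pos _).le
  refine le_trans ?_ (single_le_sum (fun c _ => ?_) (mem_univ (σ, m)))
  · rw [if_pos hσ]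
    exact le_rfl
  · split_ifs
    · exact prod_nonneg fun j _ => (gapWeight_pos _ _ _).le
    · exact le_rfl

lemma norm_exp_sum_logDist {n : ℕ} (s : Fin (n + 2) × Fin (n + 2) → ℂ) (x : Fin n → ℝ) :
    ‖Complex.exp (∑ e, s e * logDist x e)‖ = Real.exp (∑ e, (s e).re * logDist x e) := by
  rw [Complex.norm_exp, Complex.re_sum]
  simp only [Complex.re_mul_ofReal]

lemma norm_freeIntegrand_le {n : ℕ} {α β : ℝ} (hα : 0 ≤ α) (hβ : 0 ≤ β) (x : Fin n → ℝ)
    (s : Fin (n + 2) × Fin (n + 2) → ℂ) (hs : ∀ e, -α ≤ (s e).re ∧ (s e).re ≤ -β) :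
    ‖freeIntegrand s x‖ ≤ majorant n α β x := by
  rw [freeIntegrand]
  split_ifs with hx
  · rw [norm_exp_sum_logDist]
    exact exp_sum_logDist_le_majorant hα hβ x hx _ hs
  · simpa using majorant_nonneg n α β x

lemma measurable_markedPoints {n : ℕ} (a : Fin (n + 2)) :
    Measurable fun x : Fin n → ℝ => markedPoints x a := by
  refine Fin.cases ?_ (fun a => Fin.cases ?_ (fun a => ?_) a) a
  · simp [markedPoints]
  · simp [markedPoints]
  · simpa [markedPoints] using measurable_pi_apply a

lemma measurable_logDist {n : ℕ} (e : Fin (n + 2) × Fin (n + 2)) :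
    Measurable fun x : Fin n → ℝ => logDist x e :=
  Real.measurable_log.comp
    ((measurable_markedPoints e.1).sub (measurable_markedPoints e.2)).norm

lemma measurableSet_injective_markedPoints (n : ℕ) :
    MeasurableSet {x : Fin n → ℝ | Function.Injective (markedPoints x)} := by
  have : {x : Fin n → ℝ | Function.Injective (markedPoints x)} =
      ⋂ a, ⋂ b, {x | markedPoints x a = markedPoints x b → a = b} := by
    ext x
    simp [Function.Injective]
  rw [this]
  refine MeasurableSet.iInter fun a => MeasurableSet.iInter fun b => ?_
  by_cases hab : a = b
  · simp [hab]
  · simp only [hab, imp_false]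
    exact (measurableSet_eq_fun (measurable_markedPoints a) (measurable_markedPoints b)).compl

lemma measurable_freeIntegrand {n : ℕ} (s : Fin (n + 2) × Fin (n + 2) → ℂ) :
    Measurable (freeIntegrand s) := by
  refine Measurable.ite (measurableSet_injective_markedPoints n) ?_ measurable_const
  refine Complex.measurable_exp.comp (Finset.measurable_fun_sum _ fun e _ => ?_)
  exact (Complex.measurable_ofReal.comp (measurable_logDist e)).const_mul _

/-- The linear form `s ↦ ∑ e, log |x_e| * s e`. -/
noncomputable def logForm {n : ℕ} (x : Fin n → ℝ) :
    (Fin (n + 2) × Fin (n + 2) → ℂ) →L[ℂ] ℂ :=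
  ∑ e, (logDist x e : ℂ) • ContinuousLinearMap.proj e

lemma norm_logForm_le {n : ℕ} (x : Fin n → ℝ) : ‖logForm x‖ ≤ ∑ e, |logDist x e| := by
  refine ContinuousLinearMap.opNorm_le_bound _ (sum_nonneg fun e _ => abs_nonneg _) fun s => ?_
  rw [logForm, _root_.sum_apply, sum_mul]
  refine (norm_sum_le _ _).trans (sum_le_sum fun e _ => ?_)
  simp only [smul_apply, ContinuousLinearMap.proj_apply, smul_eq_mul, norm_mul,
    Complex.norm_real, Real.norm_eq_abs]
  exact mul_le_mul_of_nonneg_left (norm_le_pi_norm s e) (abs_nonneg _)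

lemma hasFDerivAt_freeIntegrand {n : ℕ} (x : Fin n → ℝ) (s : Fin (n + 2) × Fin (n + 2) → ℂ) :
    HasFDerivAt (fun s => freeIntegrand s x) (freeIntegrand s x • logForm x) s := by
  have hE : (fun s : Fin (n + 2) × Fin (n + 2) → ℂ => ∑ e, s e * (logDist x e : ℂ)) =
      logForm x := by
    ext s
    simp [logForm, mul_comm]
  by_cases hx : Function.Injective (markedPoints x)
  · simp only [freeIntegrand, if_pos hx]
    have h1 : HasFDerivAt (fun s : Fin (n + 2) × Fin (n + 2) → ℂ => ∑ e, s e * (logDist x e : ℂ))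
        (logForm x) s := by
      rw [hE]
      exact (logForm x).hasFDerivAt
    exact h1.cexp
  · have h0 : freeIntegrand s x • logForm x = 0 := by
      ext v
      simp [freeIntegrand, hx]
    rw [h0]
    simpa [freeIntegrand, hx] using hasFDerivAt_const (𝕜 := ℂ) (0 : ℂ) s

lemma measurable_logForm (n : ℕ) : Measurable (logForm : (Fin n → ℝ) → _) := by
  refine Finset.measurable_fun_sum _ fun e _ => ?_
  exact (Complex.measurable_ofReal.comp (measurable_logDist e)).smul_const _

lemma norm_smul_logForm_le {n : ℕ} {α β ε : ℝ} (hα : 0 ≤ α) (hβ : 0 ≤ β) (hε : 0 < ε)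
    (x : Fin n → ℝ) (s : Fin (n + 2) × Fin (n + 2) → ℂ)
    (hs : ∀ e, -α + ε ≤ (s e).re ∧ (s e).re ≤ -β - ε) :
    ‖freeIntegrand s x • logForm x‖ ≤ ε⁻¹ * majorant n α β x := by
  rw [norm_smul, freeIntegrand]
  split_ifs with hx
  · rw [norm_exp_sum_logDist]
    have h1 : ∑ e, |logDist x e| ≤ ε⁻¹ * Real.exp (∑ e, ε * |logDist x e|) := by
      rw [← mul_sum]
      have := Real.add_one_le_exp (ε * ∑ e, |logDist x e|)
      rw [← div_eq_inv_mul, le_div_iff₀ hε]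
      linarith
    have h2 : ∑ e, (s e).re * logDist x e + ∑ e, ε * |logDist x e| =
        ∑ e, ((s e).re + ε * SignType.sign (logDist x e)) * logDist x e := by
      rw [← sum_add_distrib]
      refine sum_congr rfl fun e _ => ?_
      rw [← sign_mul_self (logDist x e)]
      ring
    have h3 := exp_sum_logDist_le_majorant hα hβ x hx
      (fun e => (s e).re + ε * SignType.sign (logDist x e)) (fun e => by
        obtain ⟨h, h'⟩ := hs e
        rcases lt_trichotomy (logDist x e) 0 with h0 | h0 | h0
        · simp [sign_neg h0]; constructor <;> linarith
        · simp [h0]; constructor <;> linarith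
        · simp [sign_pos h0]; constructor <;> linarith)
    calc _ ≤ Real.exp (∑ e, (s e).re * logDist x e) *
          (ε⁻¹ * Real.exp (∑ e, ε * |logDist x e|)) :=
          mul_le_mul_of_nonneg_left ((norm_logForm_le x).trans h1) (Real.exp_pos _).le
      _ = ε⁻¹ * Real.exp (∑ e, (s e).re * logDist x e + ∑ e, ε * |logDist x e|) := by
          rw [Real.exp_add]; ring
      _ ≤ _ := by
          rw [h2]
          exact mul_le_mul_of_nonneg_left h3 (by positivity)
  · rw [norm_zero, zero_mul]
    exact mul_nonneg (by positivity) (majorant_nonneg n α β x)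

lemma exists_exponent_bounds {ι : Type*} [Finite ι] {a b : ℝ} (r : ι → ℝ)
    (hr : ∀ i, a < r i ∧ r i < b) : ∃ ε > 0, ∀ i, a + ε ≤ r i ∧ r i ≤ b - ε := by
  have h : ∀ᶠ ε in nhdsWithin (0 : ℝ) (Set.Ioi 0), ∀ i, a + ε ≤ r i ∧ r i ≤ b - ε := by
    refine Filter.eventually_all.2 fun i => ?_
    have hi : 0 < min (r i - a) (b - r i) := lt_min (by linarith [hr i]) (by linarith [hr i])
    filter_upwards [Ioo_mem_nhdsGT hi] with ε hε
    have := lt_min_iff.1 hε.2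
    constructor <;> linarith
  obtain ⟨ε, hε, h0⟩ := (h.and self_mem_nhdsWithin).exists
  exact ⟨ε, h0, hε⟩

/-- The integral with free exponents converges, and is complex differentiable in the exponents. -/
lemma integrable_and_differentiableAt_freeIntegrand {n : ℕ}
    (s : Fin (n + 2) × Fin (n + 2) → ℂ)
    (hs : ∀ e, -(1 / ((n : ℝ) + 1)) < (s e).re ∧ (s e).re < -(1 / ((n : ℝ) + 3))) :
    Integrable (freeIntegrand s) ∧
      DifferentiableAt ℂ (fun s => ∫ x, freeIntegrand (n := n) s x) s := by
  obtain ⟨δ, hδ, hb⟩ := exists_exponent_bounds (fun e => (s e).re) hs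
  set ε := δ / 3 with hε
  have hε0 : 0 < ε := by positivity
  set α := 1 / ((n : ℝ) + 1) - ε
  set β := 1 / ((n : ℝ) + 3) + ε
  have hβ : 0 ≤ β := by positivity
  have hα : 0 ≤ α := by
    have := hb (0, 0)
    simp only [α]
    linarith
  have hmaj := integrable_majorant n (α := α) (β := β) (by simp only [α]; linarith)
    (by simp only [β]; linarith)
  have hint : Integrable (freeIntegrand s) := by
    refine hmaj.mono' (measurable_freeIntegrand s).aestronglyMeasurable
      (Filter.Eventually.of_forall fun x => norm_freeIntegrand_le hα hβ x s fun e => ?_)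
    have := hb e
    simp only [α, β]
    constructor <;> linarith
  refine ⟨hint, ?_⟩
  refine (hasFDerivAt_integral_of_dominated_of_fderiv_le
    (F := fun s x => freeIntegrand s x) (F' := fun s x => freeIntegrand s x • logForm x)
    (bound := fun x => ε⁻¹ * majorant n α β x) (Metric.ball_mem_nhds s hε0)
    (Filter.Eventually.of_forall fun s => (measurable_freeIntegrand s).aestronglyMeasurable) hint
    ((measurable_freeIntegrand s).smul (measurable_logForm n)).aestronglyMeasurable
    (Filter.Eventually.of_forall fun x s' hs' => norm_smul_logForm_le hα hβ hε0 x s' fun e => ?_)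
    (hmaj.const_mul _)
    (Filter.Eventually.of_forall fun x s' _ => hasFDerivAt_freeIntegrand x s')).differentiableAt
  have h1 : |(s' e).re - (s e).re| < ε := by
    rw [← Complex.sub_re]
    refine (Complex.abs_re_le_norm _).trans_lt ?_
    exact (norm_le_pi_norm (s' - s) e).trans_lt (by simpa [dist_eq_norm] using hs')
  have h2 := abs_lt.1 h1
  have h3 := hb e
  simp only [α, β]
  constructor <;> linarith

end Amplitude

section KobaNielsen

lemma sqrt_mul_bounds {a b x y : ℝ} (ha : 0 ≤ a) (hx : √a < x ∧ x < √b) (hy : √a < y ∧ y < √b) :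
    a < x * y ∧ x * y < b := by
  have hb : 0 ≤ b := by
    by_contra h
    have h0 := Real.sqrt_eq_zero_of_nonpos (not_le.1 h).le
    have := Real.sqrt_nonneg a
    linarith [hx.1, hx.2]
  have h0 := Real.sqrt_nonneg a
  constructor
  · calc a = √a * √a := (Real.mul_self_sqrt ha).symm
      _ < x * y := mul_lt_mul'' hx.1 hy.1 h0 h0
  · calc x * y < √b * √b := mul_lt_mul'' hx.2 hy.2 (by linarith) (by linarith)
      _ = b := Real.mul_self_sqrt hb

lemma minkC_re_bounds {N l : ℕ} (hN : 4 ≤ N) (hl : 1 ≤ l) {B C : ℝ} (hB : 0 < B) (hBC : B < C)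
    {k k' : Fin (l + 1) → ℂ} (hk : inU N l B C k) (hk' : inU N l B C k') :
    -(2 / ((N : ℝ) - 2)) < (minkC l k k').re ∧ (minkC l k k').re < -(2 * (C - B)) := by
  have hl0 : (0 : ℝ) < l := by exact_mod_cast hl
  have hN2 : (0 : ℝ) < (N : ℝ) - 2 := by
    have : (4 : ℝ) ≤ N := by exact_mod_cast hN
    linarith
  obtain ⟨h1, h2, h3⟩ := hk
  obtain ⟨h1', h2', h3'⟩ := hk'
  have e1 := sqrt_mul_bounds (hB.le.trans hBC.le) h1 h1'
  have e2 := sqrt_mul_bounds (a := 0) le_rfl (by simpa using h2) (by simpa using h2')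
  have e3 : ∀ m : Fin l, 0 < (k m.succ).re * (k' m.succ).re ∧
      (k m.succ).re * (k' m.succ).re < B / l := fun m =>
    sqrt_mul_bounds (a := 0) le_rfl (by simpa using (h3 m).1) (by simpa using (h3' m).1)
  have e4 : ∀ m : Fin l, C / l < (k m.succ).im * (k' m.succ).im ∧
      (k m.succ).im * (k' m.succ).im < 1 / (l * ((N : ℝ) - 2)) := fun m =>
    sqrt_mul_bounds (div_nonneg (hB.le.trans hBC.le) hl0.le) (h3 m).2 (h3' m).2
  have hsum : ∀ c : ℝ, ∑ _m : Fin l, c / l = c := fun c => by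
    rw [sum_const, card_univ, Fintype.card_fin, nsmul_eq_mul]
    field_simp
  have f1 : 0 ≤ ∑ m : Fin l, (k m.succ).re * (k' m.succ).re := sum_nonneg fun m _ => (e3 m).1.le
  have f2 : ∑ m : Fin l, (k m.succ).re * (k' m.succ).re ≤ B :=
    (sum_le_sum fun m _ => (e3 m).2.le).trans_eq (hsum B)
  have f3 : C ≤ ∑ m : Fin l, (k m.succ).im * (k' m.succ).im :=
    (hsum C).symm.trans_le (sum_le_sum fun m _ => (e4 m).1.le)
  have f4 : ∑ m : Fin l, (k m.succ).im * (k' m.succ).im ≤ 1 / ((N : ℝ) - 2) := by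
    refine (sum_le_sum fun m _ => (e4 m).2.le).trans_eq ?_
    rw [← hsum (1 / ((N : ℝ) - 2))]
    refine sum_congr rfl fun _ _ => ?_
    field_simp
  have hre : (minkC l k k').re = -((k 0).re * (k' 0).re) + (k 0).im * (k' 0).im +
      (∑ m : Fin l, (k m.succ).re * (k' m.succ).re -
        ∑ m : Fin l, (k m.succ).im * (k' m.succ).im) := by
    simp only [minkC, Complex.add_re, Complex.neg_re, Complex.mul_re, Complex.re_sum,
      sum_sub_distrib]
    ring
  have hd : 2 / ((N : ℝ) - 2) = 1 / ((N : ℝ) - 2) + 1 / ((N : ℝ) - 2) := by ring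
  rw [hre, hd]
  constructor <;> linarith [e1.1, e1.2, e2.1, e2.2]

lemma minkC_comm (l : ℕ) (k k' : Fin (l + 1) → ℂ) : minkC l k k' = minkC l k' k := by
  simp only [minkC, mul_comm]

/-- The momentum attached to each marked point: `k₁` to the point `0`, `k_{N-1}` to the point `1`,
and `k_j` to the integration variable `x_j`. -/
def momentumIndex (N : ℕ) (hN : 4 ≤ N) : Fin (N - 3 + 2) → Fin (N - 1) :=
  Fin.cons ⟨0, by omega⟩ (Fin.cons ⟨N - 2, by omega⟩ fun j : Fin (N - 3) => ⟨j.1 + 1, by omega⟩)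

/-- Half the Minkowski products of the momenta attached to pairs of marked points. -/
noncomputable def halfProducts (N l : ℕ) (hN : 4 ≤ N) (k : Fin (N - 1) → Fin (l + 1) → ℂ)
    (e : Fin (N - 3 + 2) × Fin (N - 3 + 2)) : ℂ :=
  minkC l (k (momentumIndex N hN e.1)) (k (momentumIndex N hN e.2)) / 2

lemma sum_prod_eq_two_mul_sum_lt {n : ℕ} (f : Fin n → Fin n → ℂ) (hsymm : ∀ i j, f i j = f j i)
    (hdiag : ∀ i, f i i = 0) :
    ∑ i, ∑ j, f i j =
      2 * ∑ q ∈ univ.filter (fun q : Fin n × Fin n => q.1 < q.2), f q.1 q.2 := by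
  have h1 : ∑ q ∈ univ.filter (fun q : Fin n × Fin n => q.1 < q.2), f q.1 q.2 =
      ∑ i, ∑ j, if i < j then f i j else 0 := by
    rw [sum_filter, Fintype.sum_prod_type]
  have h2 : ∑ i, ∑ j, (if i < j then f i j else 0) = ∑ i, ∑ j, if j < i then f i j else 0 := by
    rw [sum_comm]
    simp only [hsymm]
  rw [two_mul]
  nth_rewrite 1 [h1]
  rw [h1]
  nth_rewrite 2 [h2]
  simp only [← sum_add_distrib]
  refine sum_congr rfl fun i _ => sum_congr rfl fun j _ => ?_
  rcases lt_trichotomy i j with h | h | h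
  · simp [h, h.not_gt]
  · subst h; simp [hdiag]
  · simp [h, h.not_gt]

lemma abs_cpow_eq_exp {t : ℝ} (ht : t ≠ 0) (s : ℂ) :
    ((|t| : ℝ) : ℂ) ^ s = Complex.exp (s * (Real.log |t| : ℝ)) := by
  rw [Complex.cpow_def_of_ne_zero (by exact_mod_cast abs_ne_zero.2 ht),
    ← Complex.ofReal_log (abs_nonneg t), mul_comm]

lemma ampIntegrand_eq_of_injective (N l : ℕ) (hN : 4 ≤ N) (k : Fin (N - 1) → Fin (l + 1) → ℂ)
    (x : Fin (N - 3) → ℝ) (hx : Function.Injective (markedPoints x)) :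
    ampIntegrand N l hN k x = Complex.exp (∑ e, halfProducts N l hN k e * logDist x e) := by
  have h0 : ∀ j, x j ≠ 0 := fun j h => by
    have : markedPoints x j.succ.succ = markedPoints x 0 := by simp [markedPoints, h]
    exact Fin.succ_ne_zero _ (hx this)
  have h1 : ∀ j, 1 - x j ≠ 0 := fun j h => by
    have : markedPoints x j.succ.succ = markedPoints x (Fin.succ 0) := by
      simp only [markedPoints, Fin.cons_succ, Fin.cons_zero]
      linarith
    exact Fin.succ_ne_zero _ (Fin.succ_injective _ (hx this))
  have h2 : ∀ i j, i < j → x i - x j ≠ 0 := fun i j hij h => by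
    have : markedPoints x i.succ.succ = markedPoints x j.succ.succ := by
      simp only [markedPoints, Fin.cons_succ]
      linarith
    exact hij.ne (Fin.succ_injective _ (Fin.succ_injective _ (hx this)))
  set f : Fin (N - 3 + 2) → Fin (N - 3 + 2) → ℂ := fun a b =>
    halfProducts N l hN k (a, b) * logDist x (a, b) with hf
  have hsymm : ∀ a b, f a b = f b a := fun a b => by
    simp only [hf, halfProducts, logDist, minkC_comm l (k (momentumIndex N hN a)), abs_sub_comm]
  have hdiag : ∀ a, f a a = 0 := fun a => by simp [hf, logDist]
  have h01 : f 0 (Fin.succ 0) = 0 := by simp [hf, logDist, markedPoints]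
  have hexp : ampIntegrand N l hN k x = Complex.exp (2 * (∑ j : Fin (N - 3),
      (f 0 j.succ.succ + f (Fin.succ 0) j.succ.succ) +
      ∑ q ∈ univ.filter (fun q : Fin (N - 3) × Fin (N - 3) => q.1 < q.2),
        f q.1.succ.succ q.2.succ.succ)) := by
    rw [mul_add, mul_sum, mul_sum, Complex.exp_add, Complex.exp_sum, Complex.exp_sum, ampIntegrand]
    congr 1
    · refine prod_congr rfl fun j _ => ?_
      rw [mul_add, Complex.exp_add, abs_cpow_eq_exp (h0 j), abs_cpow_eq_exp (h1 j)]
      congr 2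
      · simp only [hf, halfProducts, logDist, markedPoints, momentumIndex, Fin.cons_succ,
          Fin.cons_zero, zero_sub, abs_neg]
        ring
      · simp only [hf, halfProducts, logDist, markedPoints, momentumIndex, Fin.cons_succ,
          Fin.cons_zero]
        ring
    · refine prod_congr rfl fun q hq => ?_
      rw [abs_cpow_eq_exp (h2 _ _ (mem_filter.1 hq).2)]
      congr 1
      simp only [hf, halfProducts, logDist, markedPoints, momentumIndex, Fin.cons_succ]
      ring
  rw [hexp, Fintype.sum_prod_type]
  congr 1
  change _ = ∑ a, ∑ b, f a b
  simp only [Fin.sum_univ_succ (n := N - 3 + 1), Fin.sum_univ_succ (n := N - 3), sum_add_distrib,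
    hdiag, h01, hsymm (Fin.succ 0) 0, hsymm (Fin.succ (Fin.succ _)) 0,
    hsymm (Fin.succ (Fin.succ _)) (Fin.succ 0),
    sum_prod_eq_two_mul_sum_lt (fun i j => f i.succ.succ j.succ.succ)
      (fun i j => hsymm _ _) (fun i => hdiag _)]
  ring

lemma ampIntegrand_eq_zero (N l : ℕ) (hN : 4 ≤ N) (k : Fin (N - 1) → Fin (l + 1) → ℂ)
    (hk : ∀ i j, minkC l (k i) (k j) ≠ 0) (x : Fin (N - 3) → ℝ)
    (hx : ¬ Function.Injective (markedPoints x)) : ampIntegrand N l hN k x = 0 := by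
  contrapose! hx
  obtain ⟨hx1, hx2⟩ := mul_ne_zero_iff.1 hx
  rw [prod_ne_zero_iff] at hx1 hx2
  have h0 : ∀ j, x j ≠ 0 := fun j h => hx1 j (mem_univ j) (by simp [h, hk])
  have h1 : ∀ j, x j ≠ 1 := fun j h => hx1 j (mem_univ j) (by simp [h, hk])
  have h2 : ∀ i j, i < j → x i ≠ x j := fun i j hij h =>
    hx2 (i, j) (by simpa using hij) (by simp [h, hk])
  have h3 : Function.Injective x := fun i j h => by
    rcases lt_trichotomy i j with hij | hij | hij
    · exact absurd h (h2 i j hij)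
    · exact hij
    · exact absurd h.symm (h2 j i hij)
  rw [markedPoints, Fin.cons_injective_iff, Fin.cons_injective_iff]
  refine ⟨?_, ?_, h3⟩
  · rintro ⟨a, ha⟩
    revert ha
    refine Fin.cases ?_ (fun j => ?_) a
    · simp
    · simpa using h0 j
  · rintro ⟨j, hj⟩
    exact h1 j hj

lemma differentiable_halfProducts (N l : ℕ) (hN : 4 ≤ N) :
    Differentiable ℂ (halfProducts N l hN) := by
  refine differentiable_pi.2 fun e => ?_
  unfold halfProducts minkC
  fun_prop

end KobaNielsen

/-- For `N ≥ 4`, `l ≥ 1` and `0 < B < C < 1/(N-2)` with `C - B = 1/N`, the Koba-Nielsen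
amplitude integral `A^(N)(k)` converges absolutely for every
`(k₁,…,k_{N-1}) ∈ 𝒰 = 𝒰₁ × ⋯ × 𝒰_{N-1}`, and `k ↦ A^(N)(k)` is holomorphic on `𝒰`. -/
theorem kobaNielsen_amplitude_convergent_and_holomorphic (N l : ℕ) (hN : 4 ≤ N)
    (hl : 1 ≤ l) (B C : ℝ) (hB : 0 < B) (hBC : B < C) (hC : C < 1 / ((N : ℝ) - 2))
    (hCB : C - B = 1 / (N : ℝ)) :
    (∀ k : Fin (N - 1) → Fin (l + 1) → ℂ, (∀ i, inU N l B C (k i)) →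
      Integrable (ampIntegrand N l hN k)) ∧
    DifferentiableOn ℂ
      (fun k : Fin (N - 1) → Fin (l + 1) → ℂ => ∫ x, ampIntegrand N l hN k x)
      {k | ∀ i, inU N l B C (k i)} := by
  have hcast : ((N - 3 : ℕ) : ℝ) = (N : ℝ) - 3 := by
    rw [Nat.cast_sub (by omega)]
    norm_num
  have hexp : ∀ k : Fin (N - 1) → Fin (l + 1) → ℂ, (∀ i, inU N l B C (k i)) →
      ∀ e, -(1 / (((N - 3 : ℕ) : ℝ) + 1)) < (halfProducts N l hN k e).re ∧
        (halfProducts N l hN k e).re < -(1 / (((N - 3 : ℕ) : ℝ) + 3)) := by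
    intro k hk e
    have h := minkC_re_bounds hN hl hB hBC (hk (momentumIndex N hN e.1))
      (hk (momentumIndex N hN e.2))
    have h2 : (halfProducts N l hN k e).re =
        (minkC l (k (momentumIndex N hN e.1)) (k (momentumIndex N hN e.2))).re / 2 := by
      simp [halfProducts]
    have e1 : (N : ℝ) - 3 + 1 = N - 2 := by ring
    have e2 : (N : ℝ) - 3 + 3 = N := by ring
    have e3 : 2 / ((N : ℝ) - 2) = 2 * (1 / ((N : ℝ) - 2)) := by ring
    rw [hCB, e3] at h
    rw [h2, hcast, e1, e2]
    constructor <;> linarith [h.1, h.2]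
  have heq : ∀ k : Fin (N - 1) → Fin (l + 1) → ℂ, (∀ i, inU N l B C (k i)) →
      ampIntegrand N l hN k = freeIntegrand (halfProducts N l hN k) := by
    intro k hk
    funext x
    by_cases hx : Function.Injective (markedPoints x)
    · rw [ampIntegrand_eq_of_injective N l hN k x hx, freeIntegrand, if_pos hx]
    · rw [freeIntegrand, if_neg hx]
      refine ampIntegrand_eq_zero N l hN k (fun i j h => ?_) x hx
      have := (minkC_re_bounds hN hl hB hBC (hk i) (hk j)).2
      rw [h, Complex.zero_re] at this
      linarith
  refine ⟨fun k hk => ?_, fun k hk => ?_⟩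
  · rw [heq k hk]
    exact (integrable_and_differentiableAt_freeIntegrand _ (hexp k hk)).1
  · have h1 := (integrable_and_differentiableAt_freeIntegrand _ (hexp k hk)).2
    have h2 := DifferentiableAt.comp k h1 (differentiable_halfProducts N l hN k)
    refine h2.differentiableWithinAt.congr (fun k' hk' => ?_) ?_
    · simp only [Function.comp_apply, heq k' hk']
    · simp only [Function.comp_apply, heq k hk]
end

section
/- Let N ≥ 4 and l ≥ 1 be integers with N ≤ l + 1. Then there exist vectors k_1, …, k_N ∈ ℝ^{l+1} such that: (1) ∑_{i=1}^{N} k_i = 0; (2) k_i·k_i = 2 for every i = 1,…,N; and (3) −2/(N−2) < k_i·k_j < −2/N for every index pair ij with i = 1 and 2 ≤ j ≤ N−2, or i = N−1 and 2 ≤ j ≤ N−2, or 2 ≤ i < j ≤ N−2. -/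
open Finset

/-- The Minkowski product `k·k' = -k₀k'₀ + ∑_{m=1}^{l} kₘk'ₘ` of two vectors in `ℝ^{l+1}`. -/
noncomputable def minkR (l : ℕ) (k k' : Fin (l + 1) → ℝ) : ℝ :=
  -(k 0 * k' 0) + ∑ m : Fin l, k m.succ * k' m.succ

/-- Coordinates of `n + 1` vectors in `ℝⁿ`: the vector `i < n` is `a eᵢ + b (1, …, 1)`, and all
others are `-(c, …, c)`. For suitable `a`, `b`, `c` these are the vertices of a regular simplex. -/
noncomputable def simplexCoord (n : ℕ) (a b c : ℝ) (i m : ℕ) : ℝ :=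
  if i < n then b + (if i = m then a else 0) else -c

/-- The vectors of `simplexCoord`, padded with zeros to vectors of `ℝ^{l+1}` with vanishing time
component. -/
noncomputable def simplexMomentum (n l : ℕ) (a b c : ℝ) (i : ℕ) : Fin (l + 1) → ℝ :=
  Fin.cons 0 fun m : Fin l ↦ if (m : ℕ) < n then simplexCoord n a b c i m else 0

theorem minkR_simplexMomentum {n l : ℕ} (hnl : n ≤ l) (a b c : ℝ) (i j : ℕ) :
    minkR l (simplexMomentum n l a b c i) (simplexMomentum n l a b c j) =
      ∑ m ∈ range n, simplexCoord n a b c i m * simplexCoord n a b c j m := by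
  simp only [minkR, simplexMomentum, Fin.cons_zero, Fin.cons_succ, mul_zero, neg_zero, zero_add]
  rw [Fin.sum_univ_eq_sum_range (fun m ↦ (if m < n then simplexCoord n a b c i m else 0) *
    (if m < n then simplexCoord n a b c j m else 0)) l]
  symm
  apply Finset.sum_subset_zero_on_sdiff (range_subset_range.2 hnl)
  · intro m hm
    simp only [mem_sdiff, mem_range] at hm
    simp [hm.2]
  · intro m hm
    simp [mem_range.1 hm]

theorem sum_simplexCoord_mul {n i j : ℕ} (hi : i < n) (hj : j < n) (a b c : ℝ) :
    ∑ m ∈ range n, simplexCoord n a b c i m * simplexCoord n a b c j m =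
      n * b ^ 2 + 2 * a * b + (if i = j then a ^ 2 else 0) := by
  simp only [simplexCoord, hi, hj, if_true, add_mul, mul_add, sum_add_distrib, mul_ite, ite_mul,
    mul_zero, zero_mul, sum_ite_eq, mem_range, sum_const, card_range, nsmul_eq_mul]
  by_cases h : i = j
  · subst h
    simp only [if_true]
    ring
  · simp only [h, if_false]
    ring

theorem sum_simplexMomentum {n l : ℕ} {a b c : ℝ} (h : n * b + a = c) :
    ∑ i ∈ range (n + 1), simplexMomentum n l a b c i = 0 := by
  ext m
  rw [Finset.sum_apply]
  refine Fin.cases ?_ (fun m ↦ ?_) m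
  · simp [simplexMomentum]
  · by_cases hm : (m : ℕ) < n
    · have hs : ∑ i ∈ range n, simplexCoord n a b c i m = n * b + a := by
        rw [sum_congr rfl fun i hi ↦ by rw [simplexCoord, if_pos (mem_range.1 hi)]]
        simp [sum_add_distrib, hm]
      simp only [simplexMomentum, Fin.cons_succ, hm, if_true, Pi.zero_apply]
      rw [sum_range_succ, hs, h]
      simp [simplexCoord]
    · simp [simplexMomentum, hm]

/-- For `4 ≤ N ≤ l + 1` there exist momenta `k_1, …, k_N ∈ ℝ^{l+1}` (here `k i = k_{i+1}`)
satisfying momentum conservation `∑ k_i = 0`, the mass-shell conditions `k_i·k_i = 2`, and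
`-2/(N-2) < k_i·k_j < -2/N` for all the relevant index pairs: `i = 1` with `2 ≤ j ≤ N-2`,
`i = N-1` with `2 ≤ j ≤ N-2`, and `2 ≤ i < j ≤ N-2`. -/
theorem tachyon_scattering_solutions_exist (N l : ℕ) (hN : 4 ≤ N) (hl : 1 ≤ l)
    (hNl : N ≤ l + 1) :
    ∃ k : Fin N → Fin (l + 1) → ℝ,
      (∑ i, k i) = 0 ∧
      (∀ i, minkR l (k i) (k i) = 2) ∧
      (∀ j (h2 : 2 ≤ j) (h3 : j ≤ N - 2),
        -2 / ((N : ℝ) - 2) < minkR l (k ⟨0, by omega⟩) (k ⟨j - 1, by omega⟩) ∧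
          minkR l (k ⟨0, by omega⟩) (k ⟨j - 1, by omega⟩) < -2 / (N : ℝ)) ∧
      (∀ j (h2 : 2 ≤ j) (h3 : j ≤ N - 2),
        -2 / ((N : ℝ) - 2) < minkR l (k ⟨N - 2, by omega⟩) (k ⟨j - 1, by omega⟩) ∧
          minkR l (k ⟨N - 2, by omega⟩) (k ⟨j - 1, by omega⟩) < -2 / (N : ℝ)) ∧
      (∀ i j (h2 : 2 ≤ i) (hij : i < j) (h3 : j ≤ N - 2),
        -2 / ((N : ℝ) - 2) < minkR l (k ⟨i - 1, by omega⟩) (k ⟨j - 1, by omega⟩) ∧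
          minkR l (k ⟨i - 1, by omega⟩) (k ⟨j - 1, by omega⟩) < -2 / (N : ℝ)) := by
  obtain ⟨n, rfl⟩ : ∃ n, N = n + 1 := ⟨N - 1, by omega⟩
  have hnl : n ≤ l := by omega
  have hn3 : (3 : ℝ) ≤ n := by exact_mod_cast (by omega : 3 ≤ n)
  have hn0 : (n : ℝ) ≠ 0 := by positivity
  obtain ⟨a, ha⟩ : ∃ a : ℝ, a ^ 2 = 2 + 2 / n := ⟨_, Real.sq_sqrt (by positivity)⟩
  obtain ⟨c, hc⟩ : ∃ c : ℝ, c ^ 2 = 2 / n := ⟨_, Real.sq_sqrt (by positivity)⟩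
  obtain ⟨b, hb⟩ : ∃ b : ℝ, n * b + a = c := ⟨(c - a) / n, by field_simp; ring⟩
  have hab : n * b ^ 2 + 2 * a * b = -2 / n := by
    have h : (n * b + a) ^ 2 = a ^ 2 - 2 := by rw [hb, hc, ha]; ring
    rw [eq_div_iff hn0]
    linear_combination h
  have bounds : ∀ i j : ℕ, i < n → j < n → i ≠ j →
      -2 / (((n + 1 : ℕ) : ℝ) - 2) <
          minkR l (simplexMomentum n l a b c i) (simplexMomentum n l a b c j) ∧
        minkR l (simplexMomentum n l a b c i) (simplexMomentum n l a b c j) <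
          -2 / ((n + 1 : ℕ) : ℝ) := by
    intro i j hi hj hij
    rw [minkR_simplexMomentum hnl, sum_simplexCoord_mul hi hj, if_neg hij, add_zero, hab]
    push_cast
    constructor
    · rw [div_lt_div_iff₀ (by linarith) (by linarith)]
      linarith
    · rw [div_lt_div_iff₀ (by linarith) (by linarith)]
      linarith
  refine ⟨fun i ↦ simplexMomentum n l a b c i, ?_, fun i ↦ ?_, fun j h2 h3 ↦ ?_,
    fun j h2 h3 ↦ ?_, fun i j h2 hij h3 ↦ ?_⟩
  · rw [Fin.sum_univ_eq_sum_range (simplexMomentum n l a b c), sum_simplexMomentum hb]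
  · rw [minkR_simplexMomentum hnl]
    by_cases hi : (i : ℕ) < n
    · rw [sum_simplexCoord_mul hi hi, if_pos rfl, hab, ha]
      ring
    · simp only [simplexCoord, hi, if_false, sum_const, card_range, nsmul_eq_mul]
      rw [neg_mul_neg, ← pow_two, hc]
      field_simp
  · exact bounds 0 (j - 1) (by omega) (by omega) (by omega)
  · exact bounds (n + 1 - 2) (j - 1) (by omega) (by omega) (by omega)
  · exact bounds (i - 1) (j - 1) (by omega) (by omega) (by omega)
end

section
/- Let k_1, k_2, k_3, k_4 ∈ ℝ² satisfy k_1 + k_2 + k_3 + k_4 = 0 and k_i·k_i = 2 for i = 1,2,3,4, where k·k′ = −k_0 k′_0 + k_1 k′_1 is the two-dimensional Minkowski product. Then k_1·k_2 = −2, or k_2·k_3 = −2, or k_1·k_2 + k_2·k_3 = 0. -/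
/-- The two-dimensional Minkowski product `k·k' = -k₀k'₀ + k₁k'₁` on `ℝ²`. -/
def mink2 (k k' : ℝ × ℝ) : ℝ := -(k.1 * k'.1) + k.2 * k'.2

/-- Three vectors of the Minkowski plane are linearly dependent, so their Gram determinant
vanishes. -/
theorem mink2_gram_det_eq_zero (u v w : ℝ × ℝ) :
    mink2 u u * mink2 v v * mink2 w w + 2 * mink2 u v * mink2 v w * mink2 u w
      - mink2 u u * mink2 v w ^ 2 - mink2 v v * mink2 u w ^ 2 - mink2 w w * mink2 u v ^ 2 = 0 := by
  simp only [mink2]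
  ring

theorem mink2_neg_add_add_self (u v w : ℝ × ℝ) :
    mink2 (-(u + v + w)) (-(u + v + w)) = mink2 u u + mink2 v v + mink2 w w
      + 2 * (mink2 u v + mink2 v w + mink2 u w) := by
  simp only [mink2, Prod.fst_neg, Prod.snd_neg, Prod.fst_add, Prod.snd_add]
  ring

/-- For `l = 1`, `N = 4`: any `k₁, k₂, k₃, k₄ ∈ ℝ²` satisfying momentum conservation and
the mass-shell conditions `kᵢ·kᵢ = 2` satisfy `k₁·k₂ = -2`, or `k₂·k₃ = -2`, or
`k₁·k₂ + k₂·k₃ = 0`; i.e. every solution of the kinematic restrictions lies in the polar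
locus of the Veneziano amplitude. -/
theorem veneziano_l_one_kinematics_in_polar_locus (k1 k2 k3 k4 : ℝ × ℝ)
    (hsum : k1 + k2 + k3 + k4 = 0)
    (h1 : mink2 k1 k1 = 2) (h2 : mink2 k2 k2 = 2)
    (h3 : mink2 k3 k3 = 2) (h4 : mink2 k4 k4 = 2) :
    mink2 k1 k2 = -2 ∨ mink2 k2 k3 = -2 ∨ mink2 k1 k2 + mink2 k2 k3 = 0 := by
  have hG := mink2_gram_det_eq_zero k1 k2 k3
  rw [eq_neg_of_add_eq_zero_right hsum, mink2_neg_add_add_self, h1, h2, h3] at h4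
  rw [h1, h2, h3] at hG
  have hc : mink2 k1 k3 = -2 - mink2 k1 k2 - mink2 k2 k3 := by linarith
  rw [hc] at hG
  have hprod : (mink2 k1 k2 + 2) * ((mink2 k2 k3 + 2) * (mink2 k1 k2 + mink2 k2 k3)) = 0 := by
    linear_combination (-1 / 2) * hG
  rcases mul_eq_zero.mp hprod with h | h
  · exact Or.inl (by linarith)
  · rcases mul_eq_zero.mp h with h | h
    · exact Or.inr (Or.inl (by linarith))
    · exact Or.inr (Or.inr h)
end

section
/- The function x ↦ |x|^{−1/2} |1−x|^{−4/3} is not integrable on ℂ with respect to Lebesgue measure; that is, the integral ∫_ℂ |x|^{2·(−1/4)} |1−x|^{2·(−2/3)} dx diverges. -/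
open MeasureTheory

/-- A power of the norm with exponent at least minus the dimension is not integrable at infinity. -/
theorem not_integrable_indicator_norm_rpow {E : Type*} [NormedAddCommGroup E] [NormedSpace ℝ E]
    [FiniteDimensional ℝ E] [Nontrivial E] [MeasurableSpace E] [BorelSpace E]
    (μ : Measure E) [μ.IsAddHaarMeasure] {r : ℝ} (hr : -(Module.finrank ℝ E : ℝ) ≤ r) :
    ¬ Integrable (fun x : E => (Set.Ioi (1 : ℝ)).indicator (fun t => t ^ r) ‖x‖) μ := by
  rw [integrable_fun_norm_addHaar]
  intro h
  have h1 : IntegrableOn (fun t : ℝ => t ^ ((Module.finrank ℝ E - 1 : ℕ) + r)) (Set.Ioi 1) := by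
    refine (h.mono_set (Set.Ioi_subset_Ioi zero_le_one)).congr_fun ?_ measurableSet_Ioi
    intro t (ht : 1 < t)
    simp only [Set.indicator_of_mem (Set.mem_Ioi.mpr ht), smul_eq_mul]
    rw [Real.rpow_add (by linarith), Real.rpow_natCast]
  rw [integrableOn_Ioi_rpow_iff zero_lt_one, Nat.cast_sub Module.finrank_pos, Nat.cast_one] at h1
  linarith

/-- The function `x ↦ |x|^{-1/2} |1-x|^{-4/3}` is not Lebesgue integrable on `ℂ`; i.e.
the integral `∫_ℂ |x|^{2·(-1/4)} |1-x|^{2·(-2/3)} dx` diverges. -/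
theorem vanhove_zerbini_counterexample_diverges :
    ¬ Integrable (fun x : ℂ =>
        ‖x‖ ^ (2 * (-(1 : ℝ) / 4)) * ‖1 - x‖ ^ (2 * (-(2 : ℝ) / 3))) := by
  intro h
  refine not_integrable_indicator_norm_rpow (E := ℂ) volume (r := -(11 / 6))
    (by rw [Complex.finrank_real_complex]; norm_num)
    ((h.const_mul ((2 : ℝ) ^ (4 / 3 : ℝ))).mono' ?_ (.of_forall fun x => ?_))
  · exact (((measurable_id.pow_const _).indicator measurableSet_Ioi).comp
      measurable_norm).aestronglyMeasurable
  by_cases hx : 1 < ‖x‖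
  · have h0 : 0 < ‖x‖ := by linarith
    have hpos : 0 < ‖1 - x‖ := by
      rw [norm_pos_iff, sub_ne_zero]
      rintro rfl
      simp at hx
    have hle : ‖1 - x‖ ≤ 2 * ‖x‖ := by
      have := norm_sub_le 1 x
      rw [norm_one] at this
      linarith
    rw [Set.indicator_of_mem (Set.mem_Ioi.mpr hx), Real.norm_of_nonneg (by positivity)]
    calc ‖x‖ ^ (-(11 / 6) : ℝ)
        = 2 ^ (4 / 3 : ℝ) * (‖x‖ ^ (2 * (-(1 : ℝ) / 4)) *
            (2 * ‖x‖) ^ (2 * (-(2 : ℝ) / 3))) := by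
          rw [Real.mul_rpow zero_le_two h0.le, mul_left_comm (‖x‖ ^ _), ← mul_assoc,
            ← Real.rpow_add zero_lt_two, ← Real.rpow_add h0]
          norm_num
      _ ≤ _ := by
          gcongr (2 : ℝ) ^ (4 / 3 : ℝ) * (‖x‖ ^ (2 * (-(1 : ℝ) / 4)) * ?_)
          exact Real.rpow_le_rpow_of_nonpos hpos hle (by norm_num)
  · rw [Set.indicator_of_notMem (by simpa using hx), norm_zero]
    positivity
end
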